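/- Assume W is a double-well potential (W ∈ C¹(ℝ), W(-1) = W(1) = 0, W(s) > 0 for s ≠ ±1), a : ℝ → ℝ satisfies 0 < a₁ ≤ a(t) ≤ a₂ for all t ∈ ℝ, and there exists b ∈ L^∞(ℝ) with a(t) ≤ b(t) for every t ∈ ℝ, lim_{|t|→∞}(b(t) − a(t)) = 0, and such that inf_{X₁} L_b is attained. Then L_a attains its infimum at some u_a ∈ X₁; moreover, u_a is a C¹ ∩ W^{2,2}_loc solution of (u'/√(1 − |u'|²))' = a(t) W'(u) on ℝ with lim_{t→±∞}(u(t), u'(t)) = (±1, 0), and ‖u_a'‖_{L^∞(ℝ)} < 1. -/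

import Mathlib

open MeasureTheory Filter Topology Set
open scoped ENNReal

noncomputable section

/-- The class `X₁`: `W^{1,∞}(ℝ)` functions with `‖u'‖_{L^∞} ≤ 1` and `u(t) → ±1` as
`t → ±∞`. -/
def memX1 (u : ℝ → ℝ) : Prop :=
  LipschitzWith 1 u ∧ Tendsto u atTop (𝓝 (1:ℝ)) ∧ Tendsto u atBot (𝓝 (-1:ℝ))

/-- `W` is a double-well potential: `C¹`, vanishing exactly at `±1` and positive elsewhere. -/
def DoubleWell (W : ℝ → ℝ) : Prop :=
  ContDiff ℝ 1 W ∧ W (-1) = 0 ∧ W 1 = 0 ∧ ∀ s : ℝ, s ≠ -1 → s ≠ 1 → 0 < W s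

/-- The action functional `L_a(u) = ∫_ℝ (1 - √(1 - |u'|²) + a(t) W(u)) dt`. -/
def LaE (a W u : ℝ → ℝ) : ℝ≥0∞ :=
  ∫⁻ t : ℝ, ENNReal.ofReal (1 - Real.sqrt (1 - (deriv u t) ^ 2) + a t * W (u t))

/-- `u` is a `C¹ ∩ W^{2,2}_loc` solution of `(u'/√(1-|u'|²))' = a(t) W'(u)` on `ℝ`,
expressed through the integrated form of the equation. -/
def SolvesEL (a W u : ℝ → ℝ) : Prop :=
  ContDiff ℝ 1 u ∧
  ∀ s t : ℝ,
    deriv u t / Real.sqrt (1 - (deriv u t) ^ 2)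
      - deriv u s / Real.sqrt (1 - (deriv u s) ^ 2)
    = ∫ r in s..t, a r * deriv W (u r)

/-- The relativistic kinetic density `1 - √(1 - p²)`. -/
def kin (p : ℝ) : ℝ := 1 - Real.sqrt (1 - p ^ 2)

/-- The action density of `u`. -/
def dens (a W u : ℝ → ℝ) (t : ℝ) : ℝ≥0∞ :=
  ENNReal.ofReal (kin (deriv u t) + a t * W (u t))

lemma LaE_eq_lintegral_dens (a W u : ℝ → ℝ) : LaE a W u = ∫⁻ t, dens a W u t := rfl

lemma kin_nonneg (p : ℝ) : 0 ≤ kin p := by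
  have : Real.sqrt (1 - p ^ 2) ≤ 1 := Real.sqrt_le_one.2 (by nlinarith [sq_nonneg p])
  unfold kin; linarith

lemma kin_le_one (p : ℝ) : kin p ≤ 1 := by
  unfold kin; linarith [Real.sqrt_nonneg (1 - p ^ 2)]

lemma kin_zero : kin 0 = 0 := by simp [kin]

lemma continuous_kin : Continuous kin := by unfold kin; fun_prop

lemma convexOn_kin : ConvexOn ℝ (Icc (-1) 1) kin := by
  refine ⟨convex_Icc _ _, ?_⟩
  rintro x ⟨hx1, hx2⟩ y ⟨hy1, hy2⟩ α β hα hβ hαβ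
  have hx : 0 ≤ 1 - x ^ 2 := by nlinarith
  have hy : 0 ≤ 1 - y ^ 2 := by nlinarith
  have sx := Real.sq_sqrt hx
  have sy := Real.sq_sqrt hy
  simp only [smul_eq_mul, kin]
  set X := Real.sqrt (1 - x ^ 2)
  set Y := Real.sqrt (1 - y ^ 2)
  have key : α * X + β * Y ≤ Real.sqrt (1 - (α * x + β * y) ^ 2) := by
    apply Real.le_sqrt_of_sq_le
    have h1 : x * y + X * Y ≤ 1 := by nlinarith [sq_nonneg (x - y), sq_nonneg (X - Y)]
    have h2 : α * β * (x * y + X * Y) ≤ α * β * 1 :=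
      mul_le_mul_of_nonneg_left h1 (mul_nonneg hα hβ)
    have h3 : 1 = (α + β) ^ 2 := by rw [hαβ]; norm_num
    have h4 : X ^ 2 = 1 - x ^ 2 := sx
    have h5 : Y ^ 2 = 1 - y ^ 2 := sy
    calc (α * X + β * Y) ^ 2 = α ^ 2 * X ^ 2 + β ^ 2 * Y ^ 2 + 2 * (α * β * (X * Y)) := by ring
      _ = α ^ 2 * (1 - x ^ 2) + β ^ 2 * (1 - y ^ 2) + 2 * (α * β * (X * Y)) := by rw [h4, h5]
      _ ≤ (α + β) ^ 2 - (α * x + β * y) ^ 2 := by nlinarith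
      _ = _ := by rw [← h3]
  nlinarith

lemma abs_sub_le_of_lipschitz {u : ℝ → ℝ} (hu : LipschitzWith 1 u) (s t : ℝ) :
    |u t - u s| ≤ |t - s| := by
  simpa [Real.dist_eq] using hu.dist_le_mul t s

lemma lipschitzWith_one_of_le {u : ℝ → ℝ} (h : ∀ s t, s ≤ t → |u t - u s| ≤ t - s) :
    LipschitzWith 1 u := by
  refine LipschitzWith.of_dist_le_mul fun x y => ?_
  rw [Real.dist_eq, Real.dist_eq, NNReal.coe_one, one_mul]
  rcases le_total x y with hxy | hxy
  · rw [abs_sub_comm, abs_sub_comm x, abs_of_nonneg (sub_nonneg.2 hxy)]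
    exact h x y hxy
  · rw [abs_of_nonneg (sub_nonneg.2 hxy)]
    exact h y x hxy

lemma abs_deriv_le_one {u : ℝ → ℝ} (hu : LipschitzWith 1 u) (t : ℝ) : |deriv u t| ≤ 1 := by
  simpa using norm_deriv_le_of_lipschitz (x₀ := t) hu

lemma deriv_mem_Icc {u : ℝ → ℝ} (hu : LipschitzWith 1 u) (t : ℝ) :
    deriv u t ∈ Icc (-1 : ℝ) 1 := abs_le.1 (abs_deriv_le_one hu t)

lemma integral_deriv_of_lipschitz {u : ℝ → ℝ} (hu : LipschitzWith 1 u) (s t : ℝ) :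
    ∫ r in s..t, deriv u r = u t - u s :=
  (hu.lipschitzOnWith (s := uIcc s t)).absolutelyContinuousOnInterval.integral_deriv_eq_sub

/-- Jensen's inequality for the difference quotients of `u`. -/
lemma kin_slope_le {u : ℝ → ℝ} (hu : LipschitzWith 1 u) {h : ℝ} (hh : 0 < h) (t : ℝ) :
    ENNReal.ofReal (kin (h⁻¹ * (u (t + h) - u t))) ≤
      ENNReal.ofReal h⁻¹ * ∫⁻ x in Ioc t (t + h), ENNReal.ofReal (kin (deriv u x)) := by
  have hvol : volume (Ioc t (t + h)) = ENNReal.ofReal h := by simp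
  have hreal : volume.real (Ioc t (t + h)) = h := by
    simp [Measure.real, hh.le]
  have hfin : volume (Ioc t (t + h)) ≠ ∞ := by simp
  have hi1 : IntegrableOn (deriv u) (Ioc t (t + h)) volume :=
    Measure.integrableOn_of_bounded (M := 1) hfin (measurable_deriv u).aestronglyMeasurable
      (Eventually.of_forall fun x => abs_deriv_le_one hu x)
  have hi2 : IntegrableOn (kin ∘ deriv u) (Ioc t (t + h)) volume :=
    Measure.integrableOn_of_bounded (M := 1) hfin
      (continuous_kin.measurable.comp (measurable_deriv u)).aestronglyMeasurable
      (Eventually.of_forall fun x => by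
        rw [Function.comp, Real.norm_of_nonneg (kin_nonneg _)]; exact kin_le_one _)
  have hJ := convexOn_kin.map_set_average_le continuous_kin.continuousOn isClosed_Icc
    (by rw [hvol]; simpa using hh) hfin (Eventually.of_forall fun x => deriv_mem_Icc hu x) hi1 hi2
  rw [setAverage_eq, setAverage_eq, hreal, smul_eq_mul, smul_eq_mul,
    ← intervalIntegral.integral_of_le (by linarith), integral_deriv_of_lipschitz hu] at hJ
  refine (ENNReal.ofReal_le_ofReal hJ).trans ?_
  rw [ENNReal.ofReal_mul (by positivity)]
  exact mul_le_mul' le_rfl (ofReal_integral_eq_lintegral_ofReal hi2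
    (Eventually.of_forall fun x => kin_nonneg _)).le

lemma lintegral_lintegral_Ioc {f : ℝ → ℝ≥0∞} (hf : Measurable f) (h : ℝ) :
    ∫⁻ t : ℝ, ∫⁻ x in Ioc t (t + h), f x = ENNReal.ofReal h * ∫⁻ x, f x := by
  have hset : MeasurableSet {p : ℝ × ℝ | p.1 < p.2 ∧ p.2 ≤ p.1 + h} :=
    (measurableSet_lt measurable_fst measurable_snd).inter
      (measurableSet_le measurable_snd (measurable_fst.add_const h))
  have hmeas : Measurable (({p : ℝ × ℝ | p.1 < p.2 ∧ p.2 ≤ p.1 + h}).indicator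
      fun p => f p.2) := (hf.comp measurable_snd).indicator hset
  calc ∫⁻ t : ℝ, ∫⁻ x in Ioc t (t + h), f x
      = ∫⁻ t : ℝ, ∫⁻ x : ℝ, ({p : ℝ × ℝ | p.1 < p.2 ∧ p.2 ≤ p.1 + h}).indicator
          (fun p => f p.2) (t, x) := by
        refine lintegral_congr fun t => ?_
        rw [← lintegral_indicator measurableSet_Ioc]
        rfl
    _ = ∫⁻ x : ℝ, ∫⁻ t : ℝ, ({p : ℝ × ℝ | p.1 < p.2 ∧ p.2 ≤ p.1 + h}).indicator
          (fun p => f p.2) (t, x) := lintegral_lintegral_swap hmeas.aemeasurable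
    _ = ∫⁻ x : ℝ, ENNReal.ofReal h * f x := by
        refine lintegral_congr fun x => ?_
        have : (fun t => ({p : ℝ × ℝ | p.1 < p.2 ∧ p.2 ≤ p.1 + h}).indicator
            (fun p => f p.2) (t, x)) = (Ico (x - h) x).indicator fun _ => f x := by
          funext t
          simp only [indicator, mem_ofPred_eq, mem_Ico]
          congr 1
          simp only [eq_iff_iff]
          constructor <;> rintro ⟨h1, h2⟩ <;> constructor <;> linarith
        rw [this, lintegral_indicator measurableSet_Ico]
        simp [mul_comm]
    _ = _ := lintegral_const_mul _ hf

lemma lintegral_kin_slope_le {u : ℝ → ℝ} (hu : LipschitzWith 1 u) {h : ℝ} (hh : 0 < h) :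
    ∫⁻ t : ℝ, ENNReal.ofReal (kin (h⁻¹ * (u (t + h) - u t))) ≤
      ∫⁻ t : ℝ, ENNReal.ofReal (kin (deriv u t)) := by
  have hm : Measurable fun x => ENNReal.ofReal (kin (deriv u x)) :=
    (continuous_kin.measurable.comp (measurable_deriv u)).ennreal_ofReal
  calc _ ≤ ∫⁻ t : ℝ, ENNReal.ofReal h⁻¹ *
        ∫⁻ x in Ioc t (t + h), ENNReal.ofReal (kin (deriv u x)) :=
        lintegral_mono fun t => kin_slope_le hu hh t
    _ = ENNReal.ofReal h⁻¹ * ∫⁻ t : ℝ,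
        ∫⁻ x in Ioc t (t + h), ENNReal.ofReal (kin (deriv u x)) :=
        lintegral_const_mul' _ _ (by simp)
    _ = _ := by
        rw [lintegral_lintegral_Ioc hm, ← mul_assoc, ← ENNReal.ofReal_mul (by positivity),
          inv_mul_cancel₀ hh.ne']
        simp

/-- The action with the derivative replaced by a difference quotient. -/
def slopeDens (a W : ℝ → ℝ) (h : ℝ) (u : ℝ → ℝ) (t : ℝ) : ℝ≥0∞ :=
  ENNReal.ofReal (kin (h⁻¹ * (u (t + h) - u t)) + a t * W (u t))

lemma measurable_slopeDens {a W : ℝ → ℝ} (ha : Measurable a) (hW : Continuous W) (h : ℝ)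
    {u : ℝ → ℝ} (hu : Continuous u) : Measurable (slopeDens a W h u) := by
  have h1 : Measurable fun t => kin (h⁻¹ * (u (t + h) - u t)) :=
    (continuous_kin.comp (by fun_prop)).measurable
  have h2 : Measurable fun t => W (u t) := (hW.comp hu).measurable
  exact (h1.add (ha.mul h2)).ennreal_ofReal

lemma lintegral_slopeDens_le {a W : ℝ → ℝ} (ha : Measurable a) (ha0 : ∀ t, 0 ≤ a t)
    (hW : Continuous W) (hW0 : ∀ s, 0 ≤ W s) {u : ℝ → ℝ} (hu : LipschitzWith 1 u) {h : ℝ}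
    (hh : 0 < h) : ∫⁻ t, slopeDens a W h u t ≤ LaE a W u := by
  have hm : Measurable fun t => ENNReal.ofReal (a t * W (u t)) :=
    (ha.mul (hW.comp hu.continuous).measurable).ennreal_ofReal
  have hsplit : ∀ p : ℝ → ℝ, ∫⁻ t, ENNReal.ofReal (kin (p t) + a t * W (u t)) =
      (∫⁻ t, ENNReal.ofReal (kin (p t))) + ∫⁻ t, ENNReal.ofReal (a t * W (u t)) := by
    intro p
    rw [← lintegral_add_right _ hm]
    exact lintegral_congr fun t =>
      ENNReal.ofReal_add (kin_nonneg _) (mul_nonneg (ha0 t) (hW0 _))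
  change ∫⁻ t, ENNReal.ofReal (kin (h⁻¹ * (u (t + h) - u t)) + a t * W (u t)) ≤
    ∫⁻ t, ENNReal.ofReal (kin (deriv u t) + a t * W (u t))
  rw [hsplit fun t => h⁻¹ * (u (t + h) - u t), hsplit fun t => deriv u t]
  exact add_le_add (lintegral_kin_slope_le hu hh) le_rfl

/-- Lower semicontinuity of the action under pointwise convergence. -/
lemma LaE_le_liminf {a W : ℝ → ℝ} (ha : Measurable a) (ha0 : ∀ t, 0 ≤ a t)
    (hW : Continuous W) (hW0 : ∀ s, 0 ≤ W s) {v : ℕ → ℝ → ℝ} (hv : ∀ n, LipschitzWith 1 (v n))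
    {u : ℝ → ℝ} (hu : LipschitzWith 1 u) (hlim : ∀ t, Tendsto (fun n => v n t) atTop (𝓝 (u t))) :
    LaE a W u ≤ liminf (fun n => LaE a W (v n)) atTop := by
  have hslope : ∀ h : ℝ, 0 < h → ∫⁻ t, slopeDens a W h u t ≤
      liminf (fun n => LaE a W (v n)) atTop := by
    intro h hh
    have hpt : ∀ t, slopeDens a W h u t = liminf (fun n => slopeDens a W h (v n) t) atTop := by
      intro t
      refine (Tendsto.liminf_eq ?_).symm
      refine ENNReal.tendsto_ofReal (Tendsto.add ?_ ?_)
      · exact (continuous_kin.tendsto _).comp (((hlim _).sub (hlim _)).const_mul _)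
      · exact ((hW.tendsto _).comp (hlim t)).const_mul _
    rw [lintegral_congr hpt]
    refine (lintegral_liminf_le fun n => measurable_slopeDens ha hW h (hv n).continuous).trans ?_
    exact liminf_le_liminf (Eventually.of_forall fun n =>
      lintegral_slopeDens_le ha ha0 hW hW0 (hv n) hh)
  have hseq : Tendsto (fun k : ℕ => ((k : ℝ) + 1)⁻¹) atTop (𝓝[>] (0 : ℝ)) := by
    refine tendsto_nhdsWithin_iff.2 ⟨?_, Eventually.of_forall fun k => ?_⟩
    · simpa using tendsto_one_div_add_atTop_nhds_zero_nat (𝕜 := ℝ)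
    · change (0 : ℝ) < ((k : ℝ) + 1)⁻¹
      positivity
  have hpt : ∀ᵐ t, dens a W u t = liminf (fun k : ℕ => slopeDens a W ((k : ℝ) + 1)⁻¹ u t) atTop := by
    filter_upwards [hu.ae_differentiableAt_real] with t ht
    refine (Tendsto.liminf_eq ?_).symm
    refine ENNReal.tendsto_ofReal (Tendsto.add ?_ tendsto_const_nhds)
    have := (ht.hasDerivAt.tendsto_slope_zero_right).comp hseq
    exact (continuous_kin.tendsto _).comp this
  rw [LaE_eq_lintegral_dens, lintegral_congr_ae hpt]
  refine (lintegral_liminf_le fun k => measurable_slopeDens ha hW _ hu.continuous).trans ?_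
  refine (liminf_le_liminf (Eventually.of_forall fun k : ℕ =>
    hslope ((k : ℝ) + 1)⁻¹ (by positivity))).trans ?_
  simp

lemma DoubleWell.continuous {W : ℝ → ℝ} (hW : DoubleWell W) : Continuous W := hW.1.continuous

lemma DoubleWell.nonneg {W : ℝ → ℝ} (hW : DoubleWell W) (s : ℝ) : 0 ≤ W s := by
  by_cases h1 : s = -1
  · rw [h1, hW.2.1]
  by_cases h2 : s = 1
  · rw [h2, hW.2.2.1]
  exact (hW.2.2.2 s h1 h2).le

lemma DoubleWell.exists_pos_le {W : ℝ → ℝ} (hW : DoubleWell W) {x y : ℝ} (hx : -1 < x)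
    (hy : y < 1) : ∃ ν, 0 < ν ∧ ∀ s ∈ Icc x y, ν ≤ W s :=
  isCompact_Icc.exists_forall_le' hW.continuous.continuousOn fun s hs =>
    hW.2.2.2 s (by linarith [hs.1]) (by linarith [hs.2])

lemma DoubleWell.reflect {W : ℝ → ℝ} (hW : DoubleWell W) : DoubleWell fun s => W (-s) := by
  refine ⟨hW.1.comp contDiff_neg, by simpa using hW.2.2.1, hW.2.1, fun s h1 h2 => ?_⟩
  exact hW.2.2.2 _ (fun h => h2 (by linarith)) (fun h => h1 (by linarith))

lemma LaE_reflect (a W u : ℝ → ℝ) :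
    LaE (fun t => a (-t)) (fun s => W (-s)) (fun t => -u (-t)) = LaE a W u := by
  rw [LaE_eq_lintegral_dens a, ← lintegral_neg_eq_self]
  refine lintegral_congr fun t => ?_
  have : deriv (fun t => -u (-t)) t = deriv u (-t) := by
    rw [deriv.fun_neg, deriv_comp_neg, neg_neg]
  simp only [this, neg_neg]
  rfl

/-- Truncation to `[-1, 1]`. -/
def clamp (x : ℝ) : ℝ := max (-1) (min 1 x)

lemma clamp_mem (x : ℝ) : clamp x ∈ Icc (-1 : ℝ) 1 :=
  ⟨le_max_left _ _, max_le (by norm_num) (min_le_left _ _)⟩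

lemma clamp_of_mem {x : ℝ} (hx : x ∈ Icc (-1 : ℝ) 1) : clamp x = x := by
  rw [clamp, min_eq_right hx.2, max_eq_right hx.1]

lemma clamp_of_one_le {x : ℝ} (hx : 1 ≤ x) : clamp x = 1 := by
  rw [clamp, min_eq_left hx]; norm_num

lemma clamp_of_le_neg_one {x : ℝ} (hx : x ≤ -1) : clamp x = -1 := by
  rw [clamp, min_eq_right (by linarith), max_eq_left hx]

lemma continuous_clamp : Continuous clamp := by unfold clamp; fun_prop

lemma lipschitz_clamp {u : ℝ → ℝ} (hu : LipschitzWith 1 u) :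
    LipschitzWith 1 fun t => clamp (u t) := (hu.const_min 1).const_max (-1)

lemma memX1.clamp {u : ℝ → ℝ} (hu : memX1 u) : memX1 fun t => clamp (u t) := by
  refine ⟨lipschitz_clamp hu.1, ?_, ?_⟩
  · have := (continuous_clamp.tendsto 1).comp hu.2.1
    rwa [clamp_of_one_le le_rfl] at this
  · have := (continuous_clamp.tendsto (-1)).comp hu.2.2
    rwa [clamp_of_le_neg_one le_rfl] at this

lemma kin_le_of_deriv_eq_zero {p q : ℝ} (hp : p = 0) : kin p ≤ kin q := by
  rw [hp, kin_zero]; exact kin_nonneg q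

lemma LaE_clamp_le {a W : ℝ → ℝ} (ha0 : ∀ t, 0 ≤ a t) (hW : DoubleWell W) {u : ℝ → ℝ}
    (hu : Continuous u) : LaE a W (fun t => clamp (u t)) ≤ LaE a W u := by
  refine lintegral_mono fun t => ENNReal.ofReal_le_ofReal (add_le_add ?_ ?_)
  · change kin _ ≤ kin _
    rcases le_or_gt 1 (u t) with h1 | h1
    · refine kin_le_of_deriv_eq_zero (IsLocalMax.deriv_eq_zero (Eventually.of_forall fun s => ?_))
      simpa only [clamp_of_one_le h1] using (clamp_mem (u s)).2
    rcases le_or_gt (u t) (-1) with h2 | h2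
    · refine kin_le_of_deriv_eq_zero (IsLocalMin.deriv_eq_zero (Eventually.of_forall fun s => ?_))
      simpa only [clamp_of_le_neg_one h2] using (clamp_mem (u s)).1
    · have : (fun s => clamp (u s)) =ᶠ[𝓝 t] u := by
        filter_upwards [hu.continuousAt.eventually (Ioo_mem_nhds h2 h1)] with s hs
        exact clamp_of_mem ⟨hs.1.le, hs.2.le⟩
      rw [this.deriv_eq]
  · refine mul_le_mul_of_nonneg_left ?_ (ha0 t)
    change W (clamp (u t)) ≤ W (u t)
    rcases le_or_gt 1 (u t) with h1 | h1
    · rw [clamp_of_one_le h1, hW.2.2.1]; exact hW.nonneg _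
    rcases le_or_gt (u t) (-1) with h2 | h2
    · rw [clamp_of_le_neg_one h2, hW.2.1]; exact hW.nonneg _
    · rw [clamp_of_mem ⟨h2.le, h1.le⟩]

lemma mul_volume_le_setLIntegral_dens {a W u : ℝ → ℝ} {a₁ ν x y : ℝ} (ha₁ : 0 ≤ a₁)
    (ha : ∀ t, a₁ ≤ a t) (hν : 0 ≤ ν) (hW : ∀ s ∈ Icc x y, ν ≤ W s) {S : Set ℝ}
    (hS : MeasurableSet S) (hu : ∀ t ∈ S, u t ∈ Icc x y) :
    ENNReal.ofReal (a₁ * ν) * volume S ≤ ∫⁻ t in S, dens a W u t := by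
  rw [← setLIntegral_const]
  refine setLIntegral_mono' hS fun t ht => ENNReal.ofReal_le_ofReal ?_
  have h1 := hW _ (hu t ht)
  have : a₁ * ν ≤ a t * W (u t) := mul_le_mul (ha t) h1 hν (ha₁.trans (ha t))
  linarith [kin_nonneg (deriv u t)]

/-- Crossing the interval `[x, y]` costs at least a fixed amount of action. -/
lemma crossing_cost {a W u : ℝ → ℝ} (hu : LipschitzWith 1 u) {a₁ ν x y : ℝ} (ha₁ : 0 ≤ a₁)
    (ha : ∀ t, a₁ ≤ a t) (hν : 0 ≤ ν) (hW : ∀ s ∈ Icc x y, ν ≤ W s) {s t : ℝ}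
    (himg : Icc x y ⊆ u '' Icc s t) :
    ENNReal.ofReal (a₁ * ν * (y - x)) ≤ ∫⁻ r in Icc s t, dens a W u r := by
  have hS : MeasurableSet (Icc s t ∩ u ⁻¹' Icc x y) :=
    measurableSet_Icc.inter (hu.continuous.measurable measurableSet_Icc)
  have hvol : ENNReal.ofReal (y - x) ≤ volume (Icc s t ∩ u ⁻¹' Icc x y) := by
    have h1 := hu.hausdorffMeasure_image_le (d := 1) zero_le_one (Icc s t ∩ u ⁻¹' Icc x y)
    rw [hausdorffMeasure_real] at h1
    have h2 : Icc x y ⊆ u '' (Icc s t ∩ u ⁻¹' Icc x y) := by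
      intro z hz
      obtain ⟨r, hr, rfl⟩ := himg hz
      exact ⟨r, ⟨hr, hz⟩, rfl⟩
    calc ENNReal.ofReal (y - x) = volume (Icc x y) := by simp
      _ ≤ _ := measure_mono h2
      _ ≤ _ := h1
      _ = _ := by simp
  calc ENNReal.ofReal (a₁ * ν * (y - x))
      = ENNReal.ofReal (a₁ * ν) * ENNReal.ofReal (y - x) :=
        ENNReal.ofReal_mul (mul_nonneg ha₁ hν)
    _ ≤ ENNReal.ofReal (a₁ * ν) * volume (Icc s t ∩ u ⁻¹' Icc x y) := by gcongr
    _ ≤ _ := mul_volume_le_setLIntegral_dens ha₁ ha hν hW hS fun r hr => hr.2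
    _ ≤ _ := lintegral_mono_set inter_subset_left

lemma tendsto_setLIntegral_Ici {f : ℝ → ℝ≥0∞} (hf : ∫⁻ t, f t ≠ ∞) :
    Tendsto (fun N : ℝ => ∫⁻ t in Ici N, f t) atTop (𝓝 0) := by
  have := isFiniteMeasure_withDensity hf
  have h := tendsto_measure_iInter_atTop (μ := volume.withDensity f) (s := fun N : ℝ => Ici N)
    (fun N => measurableSet_Ici.nullMeasurableSet) (fun _ _ h => Ici_subset_Ici.2 h)
    ⟨0, measure_ne_top _ _⟩
  have he : ⋂ N : ℝ, Ici N = (∅ : Set ℝ) := by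
    ext x
    simp only [mem_iInter, mem_Ici, mem_empty_iff_false, iff_false, not_forall, not_le]
    exact exists_gt x
  rw [he, measure_empty] at h
  refine h.congr fun N => ?_
  exact withDensity_apply _ measurableSet_Ici

lemma tendsto_one_of_LaE_ne_top {a W u : ℝ → ℝ} (hW : DoubleWell W) {a₁ : ℝ} (ha₁ : 0 < a₁)
    (ha : ∀ t, a₁ ≤ a t) (hu : LipschitzWith 1 u) {S : ℝ} (hS : ∀ t ≥ S, u t ∈ Icc (0 : ℝ) 1)
    (hfin : LaE a W u ≠ ∞) : Tendsto u atTop (𝓝 1) := by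
  refine tendsto_order.2 ⟨fun c₀ hc₀ => ?_, fun c hc => ?_⟩
  swap
  · filter_upwards [eventually_ge_atTop S] with t ht
    linarith [(hS t ht).2]
  obtain ⟨c, hc0, hcc, hc1⟩ : ∃ c, 0 ≤ c ∧ c₀ ≤ c ∧ c < 1 :=
    ⟨max c₀ 0, le_max_right _ _, le_max_left _ _, max_lt hc₀ one_pos⟩
  set h := (1 - c) / 2 with hh
  obtain ⟨ν, hν, hνW⟩ := hW.exists_pos_le (x := 0) (y := c + h) (by norm_num) (by linarith)
  have hpos : 0 < ENNReal.ofReal (a₁ * ν) * ENNReal.ofReal h :=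
    ENNReal.mul_pos (by simpa using mul_pos ha₁ hν) (by simp; linarith)
  filter_upwards [(tendsto_setLIntegral_Ici hfin).eventually_lt_const hpos,
    eventually_ge_atTop S] with t ht htS
  refine hcc.trans_lt ?_
  by_contra! hle
  have h1 := mul_volume_le_setLIntegral_dens (u := u) ha₁.le ha hν.le hνW
    (S := Icc t (t + h)) measurableSet_Icc fun r hr => by
      refine ⟨(hS r (htS.trans hr.1)).1, ?_⟩
      have := abs_le.1 (abs_sub_le_of_lipschitz hu t r)
      rw [abs_of_nonneg (by linarith [hr.1])] at this
      linarith [hr.2]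
  rw [Real.volume_Icc, add_sub_cancel_left] at h1
  have h2 : ∫⁻ r in Icc t (t + h), dens a W u r ≤ ∫⁻ r in Ici t, dens a W u r :=
    lintegral_mono_set Icc_subset_Ici_self
  exact absurd (h1.trans h2) (not_le.2 ht)

lemma tendsto_neg_one_of_LaE_ne_top {a W u : ℝ → ℝ} (hW : DoubleWell W) {a₁ : ℝ} (ha₁ : 0 < a₁)
    (ha : ∀ t, a₁ ≤ a t) (hu : LipschitzWith 1 u) {S : ℝ}
    (hS : ∀ t ≤ -S, u t ∈ Icc (-1 : ℝ) 0) (hfin : LaE a W u ≠ ∞) :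
    Tendsto u atBot (𝓝 (-1)) := by
  have h := tendsto_one_of_LaE_ne_top (u := fun t => -u (-t)) (S := S) hW.reflect ha₁
    (fun t => ha (-t)) (lipschitzWith_one_of_le fun s t hst => by
      have := abs_sub_le_of_lipschitz hu (-t) (-s)
      rw [abs_of_nonneg (by linarith : (0 : ℝ) ≤ -s - -t)] at this
      rw [neg_sub_neg]; linarith)
    (fun t ht => by
      have := hS (-t) (by linarith)
      exact ⟨by linarith [this.2], by linarith [this.1]⟩) (by rwa [LaE_reflect])
  have h2 := (h.comp tendsto_neg_atBot_atTop).neg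
  refine h2.congr fun t => ?_
  simp

/-- The competitor equal to `u` on `[p, q]` and joined to `±1` by unit-slope ramps. -/
def cut (p q : ℝ) (u : ℝ → ℝ) (t : ℝ) : ℝ :=
  clamp (u (max p (min q t)) + (t - max p (min q t)))

lemma lipschitz_cut {u : ℝ → ℝ} (hu : LipschitzWith 1 u) (p q : ℝ) : LipschitzWith 1 (cut p q u) := by
  refine lipschitz_clamp (lipschitzWith_one_of_le fun s t hst => ?_)
  set cs := max p (min q s) with hcs
  set ct := max p (min q t) with hct
  have h1 : cs ≤ ct := max_le_max le_rfl (min_le_min le_rfl hst)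
  have h2 : ct - cs ≤ t - s := by
    rw [hcs, hct]
    rcases max_cases p (min q t) with h | h <;> rcases max_cases p (min q s) with h' | h' <;>
    rcases min_cases q t with h'' | h'' <;> rcases min_cases q s with h''' | h''' <;> linarith
  have h3 := abs_le.1 (abs_sub_le_of_lipschitz hu cs ct)
  rw [abs_of_nonneg (by linarith)] at h3
  rw [abs_le]
  constructor <;> linarith [h3.1, h3.2]

lemma cut_eq_self {u : ℝ → ℝ} (hu1 : ∀ t, u t ∈ Icc (-1 : ℝ) 1) {p q t : ℝ} (ht : t ∈ Icc p q) :
    cut p q u t = u t := by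
  rw [cut, min_eq_right ht.2, max_eq_right ht.1, sub_self, add_zero, clamp_of_mem (hu1 t)]

lemma cut_eq_one {u : ℝ → ℝ} {p q δ : ℝ} (hpq : p ≤ q) (hδ : 0 ≤ δ) (hq : 1 - δ ≤ u q) {t : ℝ}
    (ht : q + δ ≤ t) : cut p q u t = 1 := by
  rw [cut, min_eq_left (by linarith), max_eq_right hpq, clamp_of_one_le]
  linarith

lemma cut_eq_neg_one {u : ℝ → ℝ} {p q δ : ℝ} (hpq : p ≤ q) (hδ : 0 ≤ δ) (hp : u p ≤ -1 + δ) {t : ℝ}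
    (ht : t ≤ p - δ) : cut p q u t = -1 := by
  rw [cut, min_eq_right (by linarith), max_eq_left (by linarith), clamp_of_le_neg_one]
  linarith

lemma memX1_cut {u : ℝ → ℝ} (hu : LipschitzWith 1 u) {p q δ : ℝ} (hpq : p ≤ q) (hδ : 0 ≤ δ)
    (hp : u p ≤ -1 + δ) (hq : 1 - δ ≤ u q) : memX1 (cut p q u) := by
  refine ⟨lipschitz_cut hu p q, tendsto_const_nhds.congr' ?_, tendsto_const_nhds.congr' ?_⟩
  · filter_upwards [eventually_ge_atTop (q + δ)] with t ht
    exact (cut_eq_one hpq hδ hq ht).symm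
  · filter_upwards [eventually_le_atBot (p - δ)] with t ht
    exact (cut_eq_neg_one hpq hδ hp ht).symm

lemma dens_cut_eq_zero {a W u : ℝ → ℝ} (hW : DoubleWell W) {p q δ : ℝ} (hpq : p ≤ q) (hδ : 0 ≤ δ)
    (hp : u p ≤ -1 + δ) (hq : 1 - δ ≤ u q) {t : ℝ} (ht : t ∉ Icc (p - δ) (q + δ)) :
    dens a W (cut p q u) t = 0 := by
  rcases lt_or_ge t (p - δ) with h | h
  · have : cut p q u =ᶠ[𝓝 t] fun _ => -1 := by
      filter_upwards [Iio_mem_nhds h] with s hs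
      exact cut_eq_neg_one hpq hδ hp (le_of_lt hs)
    simp [dens, this.deriv_eq, this.eq_of_nhds, hW.2.1, kin_zero]
  · have h' : q + δ < t := by
      by_contra! h'; exact ht ⟨h, h'⟩
    have : cut p q u =ᶠ[𝓝 t] fun _ => 1 := by
      filter_upwards [Ioi_mem_nhds h'] with s hs
      exact cut_eq_one hpq hδ hq (le_of_lt hs)
    simp [dens, this.deriv_eq, this.eq_of_nhds, hW.2.2.1, kin_zero]

lemma dens_le_of_le {a W v : ℝ → ℝ} (hW : DoubleWell W) {a₂ M : ℝ} (ha : ∀ t, a t ≤ a₂)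
    (ha0 : 0 ≤ a₂) {t : ℝ} (hM : W (v t) ≤ M) :
    dens a W v t ≤ ENNReal.ofReal (1 + a₂ * M) := by
  refine ENNReal.ofReal_le_ofReal (add_le_add (kin_le_one _) ?_)
  exact mul_le_mul (ha t) hM (hW.nonneg _) ha0

lemma LaE_cut_le {a W u : ℝ → ℝ} (hW : DoubleWell W) (hu1 : ∀ t, u t ∈ Icc (-1 : ℝ) 1)
    {a₂ M : ℝ} (ha : ∀ t, a t ≤ a₂) (ha0 : 0 ≤ a₂) (hM : ∀ s ∈ Icc (-1 : ℝ) 1, W s ≤ M)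
    {p q δ : ℝ} (hpq : p ≤ q) (hδ : 0 ≤ δ) (hp : u p ≤ -1 + δ) (hq : 1 - δ ≤ u q) :
    LaE a W (cut p q u) ≤
      (∫⁻ t in Ioo p q, dens a W u t) + ENNReal.ofReal (2 * δ * (1 + a₂ * M)) := by
  have hM0 : 0 ≤ M := (hW.nonneg 1).trans (hM 1 (by norm_num))
  rw [LaE_eq_lintegral_dens, ← lintegral_add_compl _ (measurableSet_Ioo (a := p) (b := q))]
  refine add_le_add (le_of_eq ?_) ?_
  · refine setLIntegral_congr_fun measurableSet_Ioo fun t ht => ?_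
    have : cut p q u =ᶠ[𝓝 t] u := by
      filter_upwards [Ioo_mem_nhds ht.1 ht.2] with s hs
      exact cut_eq_self hu1 (Ioo_subset_Icc_self hs)
    simp only [dens, this.deriv_eq, this.eq_of_nhds]
  · have hbound : ∀ t ∈ (Ioo p q)ᶜ, dens a W (cut p q u) t ≤
        (Icc (p - δ) p ∪ Icc q (q + δ)).indicator
          (fun _ => ENNReal.ofReal (1 + a₂ * M)) t := by
      intro t ht
      by_cases h : t ∈ Icc (p - δ) p ∪ Icc q (q + δ)
      · rw [indicator_of_mem h]
        exact dens_le_of_le hW ha ha0 (hM _ (clamp_mem _))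
      · rw [dens_cut_eq_zero hW hpq hδ hp hq]
        · exact zero_le
        · intro h'
          apply h
          by_cases htp : t ≤ p
          · exact Or.inl ⟨h'.1, htp⟩
          · refine Or.inr ⟨?_, h'.2⟩
            by_contra! htq
            exact ht ⟨not_le.1 htp, htq⟩
    have hms : MeasurableSet (Icc (p - δ) p ∪ Icc q (q + δ)) :=
      measurableSet_Icc.union measurableSet_Icc
    calc ∫⁻ t in (Ioo p q)ᶜ, dens a W (cut p q u) t
        ≤ ∫⁻ t in (Ioo p q)ᶜ, (Icc (p - δ) p ∪ Icc q (q + δ)).indicator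
          (fun _ => ENNReal.ofReal (1 + a₂ * M)) t :=
          setLIntegral_mono' measurableSet_Ioo.compl hbound
      _ ≤ ∫⁻ t, (Icc (p - δ) p ∪ Icc q (q + δ)).indicator
          (fun _ => ENNReal.ofReal (1 + a₂ * M)) t := setLIntegral_le_lintegral _ _
      _ = ENNReal.ofReal (1 + a₂ * M) * volume (Icc (p - δ) p ∪ Icc q (q + δ)) := by
          rw [lintegral_indicator hms, setLIntegral_const]
      _ ≤ ENNReal.ofReal (1 + a₂ * M) * (ENNReal.ofReal δ + ENNReal.ofReal δ) := by
          gcongr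
          refine (measure_union_le _ _).trans ?_
          simp
      _ = _ := by
          rw [← ENNReal.ofReal_add hδ hδ, ← ENNReal.ofReal_mul (by positivity)]
          congr 1; ring

lemma LaE_cut_le_add {a b W u : ℝ → ℝ} (hW : DoubleWell W) {M ε : ℝ}
    (hM : ∀ s ∈ Icc (-1 : ℝ) 1, W s ≤ M) (hε : 0 ≤ ε)
    {p q δ : ℝ} (hpq : p ≤ q) (hδ : 0 ≤ δ) (hp : u p ≤ -1 + δ) (hq : 1 - δ ≤ u q)
    (hab : ∀ t ∈ Icc (p - δ) (q + δ), b t - a t ≤ ε) :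
    LaE b W (cut p q u) ≤
      LaE a W (cut p q u) + ENNReal.ofReal (ε * M * (q - p + 2 * δ)) := by
  have hM0 : 0 ≤ M := (hW.nonneg 1).trans (hM 1 (by norm_num))
  have hbound : ∀ t, dens b W (cut p q u) t ≤ dens a W (cut p q u) t +
      (Icc (p - δ) (q + δ)).indicator (fun _ => ENNReal.ofReal (ε * M)) t := by
    intro t
    by_cases h : t ∈ Icc (p - δ) (q + δ)
    · rw [indicator_of_mem h]
      refine le_trans (ENNReal.ofReal_le_ofReal ?_) ENNReal.ofReal_add_le
      have h1 : (b t - a t) * W (cut p q u t) ≤ ε * M :=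
        mul_le_mul (hab t h) (hM _ (clamp_mem _)) (hW.nonneg _) hε
      linarith
    · rw [dens_cut_eq_zero hW hpq hδ hp hq h]
      exact zero_le
  calc LaE b W (cut p q u) ≤ ∫⁻ t, (dens a W (cut p q u) t +
        (Icc (p - δ) (q + δ)).indicator (fun _ => ENNReal.ofReal (ε * M)) t) :=
        lintegral_mono hbound
    _ = LaE a W (cut p q u) + ENNReal.ofReal (ε * M) * volume (Icc (p - δ) (q + δ)) := by
        rw [lintegral_add_right _ (measurable_const.indicator measurableSet_Icc),
          lintegral_indicator measurableSet_Icc, setLIntegral_const]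
        rfl
    _ = _ := by
        rw [Real.volume_Icc, ← ENNReal.ofReal_mul (by positivity)]
        congr 3; ring

lemma exists_transition {u : ℝ → ℝ} (hu : memX1 u) {δ : ℝ} (hδ : 0 < δ) :
    ∃ p q, p ≤ q ∧ u p ≤ -1 + δ ∧ 1 - δ ≤ u q ∧ ∀ t ∈ Ioo p q, u t ∈ Icc (-1 + δ) (1 - δ) := by
  have hc := hu.1.continuous
  obtain ⟨t₀, ht₀⟩ := (hu.2.2.eventually_lt_const (show (-1 : ℝ) < -1 + δ by linarith)).exists
  obtain ⟨t₁, ht₁, ht₁'⟩ := ((hu.2.1.eventually_const_lt (show 1 - δ < (1 : ℝ) by linarith)).and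
    (eventually_ge_atTop t₀)).exists
  obtain ⟨q, ⟨hq, hqu⟩, hqmin⟩ := (isCompact_Icc (a := t₀) (b := t₁)).inter_right
    (isClosed_Ici.preimage hc) |>.exists_isLeast (s := Icc t₀ t₁ ∩ u ⁻¹' Ici (1 - δ))
    ⟨t₁, ⟨ht₁', le_rfl⟩, ht₁.le⟩
  obtain ⟨p, ⟨hp, hpu⟩, hpmax⟩ := (isCompact_Icc (a := t₀) (b := q)).inter_right
    (isClosed_Iic.preimage hc) |>.exists_isGreatest (s := Icc t₀ q ∩ u ⁻¹' Iic (-1 + δ))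
    ⟨t₀, ⟨le_rfl, hq.1⟩, ht₀.le⟩
  refine ⟨p, q, hp.2, hpu, hqu, fun t ht => ⟨?_, ?_⟩⟩
  · by_contra! h
    exact absurd (hpmax ⟨⟨hp.1.trans ht.1.le, ht.2.le⟩, h.le⟩) (not_le.2 ht.1)
  · by_contra! h
    exact absurd (hqmin ⟨⟨hp.1.trans ht.1.le, ht.2.le.trans hq.2⟩, h.le⟩) (not_le.2 ht.2)

lemma exists_localization {a b W : ℝ → ℝ} {a₁ a₂ : ℝ} (hW : DoubleWell W) (ha₁ : 0 < a₁)
    (ha : ∀ t : ℝ, a₁ ≤ a t ∧ a t ≤ a₂)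
    (hlimT : Tendsto (fun t : ℝ => b t - a t) atTop (𝓝 (0 : ℝ)))
    (hlimB : Tendsto (fun t : ℝ => b t - a t) atBot (𝓝 (0 : ℝ)))
    {mA mB : ℝ≥0∞} (hlt : mA < mB)
    (hA : ∀ v, memX1 v → mA ≤ LaE a W v) (hB : ∀ v, memX1 v → mB ≤ LaE b W v) :
    ∃ η : ℝ, 0 < η ∧ ∃ S : ℝ, ∀ u, memX1 u → (∀ t, u t ∈ Icc (-1 : ℝ) 1) →
      LaE a W u ≤ mA + ENNReal.ofReal η →
      (∀ t ≥ S, 0 ≤ u t) ∧ ∀ t ≤ -S, u t ≤ 0 := by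
  have ha₂ : 0 ≤ a₂ := ha₁.le.trans ((ha 0).1.trans (ha 0).2)
  obtain ⟨M, hM⟩ : ∃ M, ∀ s ∈ Icc (-1 : ℝ) 1, W s ≤ M := by
    obtain ⟨M, hM⟩ := (isCompact_Icc (a := (-1 : ℝ)) (b := 1)).bddAbove_image
      hW.continuous.continuousOn
    exact ⟨M, fun s hs => hM ⟨s, hs, rfl⟩⟩
  have hM0 : 0 ≤ M := (hW.nonneg 1).trans (hM 1 (by norm_num))
  obtain ⟨μ, hμ, hμW⟩ := hW.exists_pos_le (x := -(1 / 2)) (y := 1 / 2) (by norm_num) (by norm_num)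
  obtain ⟨r, hr, hrlt⟩ := ENNReal.lt_iff_exists_add_pos_lt.1 hlt
  have hr' : (0 : ℝ) < r := hr
  set κ := a₁ * μ * (1 / 2) with hκ
  have hκ0 : 0 < κ := by positivity
  obtain ⟨η, hη, hηr, hηκ⟩ : ∃ η : ℝ, 0 < η ∧ η ≤ r ∧ η ≤ κ :=
    ⟨min r κ, lt_min hr' hκ0, min_le_left _ _, min_le_right _ _⟩
  set K := 1 + a₂ * M with hK
  have hK1 : 1 ≤ K := by nlinarith [mul_nonneg ha₂ hM0]
  obtain ⟨δ, hδ, hδ2, hδK⟩ : ∃ δ : ℝ, 0 < δ ∧ δ ≤ 1 / 2 ∧ 2 * δ * K ≤ η / 4 := by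
    refine ⟨min (1 / 2) (η / (8 * K)), by positivity, min_le_left _ _, ?_⟩
    have h1 : min (1 / 2) (η / (8 * K)) ≤ η / (8 * K) := min_le_right _ _
    have h2 : η / (8 * K) * K = η / 8 := by field_simp
    nlinarith
  obtain ⟨ν, hν, hνW⟩ := hW.exists_pos_le (x := -1 + δ) (y := 1 - δ) (by linarith) (by linarith)
  set T := (mA.toReal + η) / (a₁ * ν) with hT
  have hT0 : 0 ≤ T := by positivity
  obtain ⟨ε, hε, hεη⟩ : ∃ ε : ℝ, 0 < ε ∧ ε * M * (T + 2 * δ) ≤ η / 4 := by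
    refine ⟨η / (4 * (M * (T + 2 * δ) + 1)), by positivity, ?_⟩
    rw [mul_assoc, div_mul_eq_mul_div, div_le_div_iff₀ (by positivity) (by norm_num)]
    nlinarith
  obtain ⟨R, hR⟩ : ∃ R : ℝ, ∀ t, (R ≤ t ∨ t ≤ -R) → b t - a t ≤ ε := by
    obtain ⟨R₁, h₁⟩ := eventually_atTop.1 (hlimT.eventually_lt_const hε)
    obtain ⟨R₂, h₂⟩ := eventually_atBot.1 (hlimB.eventually_lt_const hε)
    refine ⟨max R₁ (-R₂), fun t ht => ?_⟩
    rcases ht with h | h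
    · exact (h₁ t ((le_max_left _ _).trans h)).le
    · exact (h₂ t (by linarith [le_max_right R₁ (-R₂)])).le
  refine ⟨η / 4, by positivity, R + T + 2 * δ, fun u hu hu1 hle => ?_⟩
  obtain ⟨p, q, hpq, hp, hq, hin⟩ := exists_transition hu hδ
  have hv := memX1_cut hu.1 hpq hδ.le hp hq
  have hcut := LaE_cut_le hW hu1 (fun t => (ha t).2) ha₂ hM hpq hδ.le hp hq
  have hcut' : LaE a W (cut p q u) ≤
      (∫⁻ t in Ioo p q, dens a W u t) + ENNReal.ofReal (η / 4) :=
    hcut.trans (add_le_add le_rfl (ENNReal.ofReal_le_ofReal hδK))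
  have hmA : mA ≠ ∞ := ne_top_of_lt hlt
  have hufin : LaE a W u ≠ ∞ := ne_top_of_le_ne_top (by simp [hmA]) hle
  have hsum : (∫⁻ t in Ioo p q, dens a W u t) + ∫⁻ t in (Ioo p q)ᶜ, dens a W u t = LaE a W u :=
    lintegral_add_compl _ measurableSet_Ioo
  have hIle : ∫⁻ t in Ioo p q, dens a W u t ≤ LaE a W u := setLIntegral_le_lintegral _ _
  have hIfin : ∫⁻ t in Ioo p q, dens a W u t ≠ ∞ := ne_top_of_le_ne_top hufin hIle
  have hout : ∫⁻ t in (Ioo p q)ᶜ, dens a W u t ≤ ENNReal.ofReal (η / 2) := by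
    refine ENNReal.le_of_add_le_add_left hIfin ?_
    rw [hsum]
    calc LaE a W u ≤ mA + ENNReal.ofReal (η / 4) := hle
      _ ≤ ((∫⁻ t in Ioo p q, dens a W u t) + ENNReal.ofReal (η / 4)) + ENNReal.ofReal (η / 4) :=
          add_le_add ((hA _ hv).trans hcut') le_rfl
      _ = _ := by
          rw [add_assoc, ← ENNReal.ofReal_add (by positivity) (by positivity)]
          congr 2; ring
  have hlen : q - p ≤ T := by
    have h1 := mul_volume_le_setLIntegral_dens ha₁.le (fun t => (ha t).1) hν.le hνW
      measurableSet_Ioo hin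
    rw [Real.volume_Ioo, ← ENNReal.ofReal_mul (by positivity)] at h1
    have h2 : ENNReal.ofReal (a₁ * ν * (q - p)) ≤ ENNReal.ofReal (mA.toReal + η / 4) := by
      rw [ENNReal.ofReal_add (by positivity) (by positivity), ENNReal.ofReal_toReal hmA]
      exact h1.trans (hIle.trans hle)
    rw [ENNReal.ofReal_le_ofReal_iff (by positivity)] at h2
    rw [hT, le_div_iff₀ (by positivity)]
    linarith
  have hcross : ∀ s t, s ≤ t → Icc s t ⊆ (Ioo p q)ᶜ → ∀ x y, -(1 / 2) ≤ x → y ≤ 1 / 2 →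
      y - x = 1 / 2 → ¬ Icc x y ⊆ u '' Icc s t := by
    intro s t _ hsub x y hx hy hxy himg
    have h1 := crossing_cost hu.1 ha₁.le (fun t => (ha t).1) hμ.le
      (fun z hz => hμW z ⟨hx.trans hz.1, hz.2.trans hy⟩) himg
    rw [hxy] at h1
    have h2 := h1.trans ((lintegral_mono_set hsub).trans hout)
    rw [ENNReal.ofReal_le_ofReal_iff (by positivity)] at h2
    linarith
  have hright : ∀ t ≥ q, 0 ≤ u t := by
    intro t ht
    by_contra! hneg
    refine hcross q t ht (fun r hr hr' => absurd hr.1 (not_le.2 hr'.2)) 0 (1 / 2) (by norm_num)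
      le_rfl (by norm_num) ?_
    exact (Icc_subset_Icc hneg.le (by linarith)).trans
      (intermediate_value_Icc' ht hu.1.continuous.continuousOn)
  have hleft : ∀ t ≤ p, u t ≤ 0 := by
    intro t ht
    by_contra! hpos
    refine hcross t p ht (fun r hr hr' => absurd hr.2 (not_le.2 hr'.1)) (-(1 / 2)) 0 le_rfl
      (by norm_num) (by norm_num) ?_
    exact (Icc_subset_Icc (by linarith) hpos.le).trans
      (intermediate_value_Icc' ht hu.1.continuous.continuousOn)
  have hwin : ¬ ∀ t ∈ Icc (p - δ) (q + δ), b t - a t ≤ ε := by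
    intro hab
    have h1 := LaE_cut_le_add hW hM hε.le hpq hδ.le hp hq hab
    have h2 : ε * M * (q - p + 2 * δ) ≤ η / 4 :=
      le_trans (mul_le_mul_of_nonneg_left (by linarith) (by positivity)) hεη
    have h3 : mB ≤ mA + r := by
      calc mB ≤ LaE b W (cut p q u) := hB _ hv
        _ ≤ LaE a W (cut p q u) + ENNReal.ofReal (η / 4) :=
            h1.trans (add_le_add le_rfl (ENNReal.ofReal_le_ofReal h2))
        _ ≤ (LaE a W u + ENNReal.ofReal (η / 4)) + ENNReal.ofReal (η / 4) :=
            add_le_add (hcut'.trans (add_le_add hIle le_rfl)) le_rfl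
        _ ≤ ((mA + ENNReal.ofReal (η / 4)) + ENNReal.ofReal (η / 4)) + ENNReal.ofReal (η / 4) :=
            add_le_add (add_le_add hle le_rfl) le_rfl
        _ = mA + ENNReal.ofReal (3 * (η / 4)) := by
            rw [add_assoc, add_assoc, ← ENNReal.ofReal_add (by positivity) (by positivity),
              ← ENNReal.ofReal_add (by positivity) (by positivity)]
            congr 2; ring
        _ ≤ mA + r := by
            refine add_le_add le_rfl ?_
            rw [← ENNReal.ofReal_coe_nnreal]
            exact ENNReal.ofReal_le_ofReal (by linarith)
    exact absurd h3 (not_le.2 hrlt)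
  have hq_le : q ≤ R + T + 2 * δ := by
    by_contra! h
    exact hwin fun t ht => hR t (Or.inl (by linarith [ht.1]))
  have hp_ge : -(R + T + 2 * δ) ≤ p := by
    by_contra! h
    exact hwin fun t ht => hR t (Or.inr (by linarith [ht.2]))
  exact ⟨fun t ht => hright t (hq_le.trans ht), fun t ht => hleft t (ht.trans hp_ge)⟩

/-- Pointwise sequential compactness of uniformly bounded 1-Lipschitz functions. -/
lemma exists_subseq_tendsto {v : ℕ → ℝ → ℝ} (hv : ∀ n, LipschitzWith 1 (v n))
    (hv1 : ∀ n t, v n t ∈ Icc (-1 : ℝ) 1) :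
    ∃ φ : ℕ → ℕ, StrictMono φ ∧ ∃ u : ℝ → ℝ, LipschitzWith 1 u ∧
      ∀ t, Tendsto (fun n => v (φ n) t) atTop (𝓝 (u t)) := by
  obtain ⟨x, -, φ, hφ, hx⟩ := (isCompact_univ_pi fun _ : ℚ => isCompact_Icc
    (a := (-1 : ℝ)) (b := 1)).tendsto_subseq (x := fun n (q : ℚ) => v n q)
    fun n q _ => hv1 n q
  have hx' : ∀ q : ℚ, Tendsto (fun n => v (φ n) q) atTop (𝓝 (x q)) := fun q =>
    (tendsto_pi_nhds.1 hx) q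
  have hcau : ∀ t, CauchySeq fun n => v (φ n) t := by
    intro t
    refine Metric.cauchySeq_iff'.2 fun ε hε => ?_
    obtain ⟨q, hq1, hq2⟩ := exists_rat_btwn (show t < t + ε / 3 by linarith)
    obtain ⟨N, hN⟩ := Metric.cauchySeq_iff'.1 (hx' q).cauchySeq (ε / 3) (by positivity)
    refine ⟨N, fun n hn => ?_⟩
    have h1 := abs_lt.1 (hN n hn)
    have h2 := abs_le.1 (abs_sub_le_of_lipschitz (hv (φ n)) t q)
    have h3 := abs_le.1 (abs_sub_le_of_lipschitz (hv (φ N)) t q)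
    rw [abs_of_nonneg (by linarith)] at h2 h3
    rw [Real.dist_eq, abs_lt]
    constructor <;> linarith [h1.1, h1.2, h2.1, h2.2, h3.1, h3.2]
  choose u hu using fun t => cauchySeq_tendsto_of_complete (hcau t)
  refine ⟨φ, hφ, u, lipschitzWith_one_of_le fun s t hst => ?_, hu⟩
  refine le_of_tendsto ((hu t).sub (hu s)).abs (Eventually.of_forall fun n => ?_)
  have := abs_sub_le_of_lipschitz (hv (φ n)) s t
  rwa [abs_of_nonneg (by linarith : 0 ≤ t - s)] at this

lemma exists_memX1_LaE_ne_top {a W : ℝ → ℝ} {a₂ : ℝ} (hW : DoubleWell W)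
    (ha₂ : 0 ≤ a₂) (ha : ∀ t : ℝ, a t ≤ a₂) : ∃ v, memX1 v ∧ LaE a W v ≠ ∞ := by
  obtain ⟨M, hM⟩ := (isCompact_Icc (a := (-1 : ℝ)) (b := 1)).bddAbove_image
    hW.continuous.continuousOn
  have hu : LipschitzWith 1 fun _ : ℝ => (0 : ℝ) := LipschitzWith.const' 0
  refine ⟨cut 0 0 fun _ => 0, memX1_cut hu le_rfl zero_le_one (by simp) (by simp), ?_⟩
  have h := LaE_cut_le (a := a) (u := fun _ => 0) hW (fun _ => by norm_num) ha ha₂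
    (fun s hs => hM ⟨s, hs, rfl⟩) (le_refl (0 : ℝ)) zero_le_one (by simp) (by simp)
  refine ne_top_of_le_ne_top (ENNReal.add_ne_top.2 ⟨?_, ENNReal.ofReal_ne_top⟩) h
  simp

lemma exists_minimizer {W a b : ℝ → ℝ} {a₁ a₂ : ℝ}
    (hW : DoubleWell W) (hma : Measurable a)
    (ha₁ : 0 < a₁) (ha : ∀ t : ℝ, a₁ ≤ a t ∧ a t ≤ a₂)
    (hab : ∀ t : ℝ, a t ≤ b t)
    (hlimT : Tendsto (fun t : ℝ => b t - a t) atTop (𝓝 (0 : ℝ)))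
    (hlimB : Tendsto (fun t : ℝ => b t - a t) atBot (𝓝 (0 : ℝ)))
    (hbmin : ∃ w : ℝ → ℝ, memX1 w ∧ ∀ v : ℝ → ℝ, memX1 v → LaE b W w ≤ LaE b W v) :
    ∃ u : ℝ → ℝ, memX1 u ∧ ∀ v : ℝ → ℝ, memX1 v → LaE a W u ≤ LaE a W v := by
  obtain ⟨w, hw, hwmin⟩ := hbmin
  have ha0 : ∀ t, 0 ≤ a t := fun t => ha₁.le.trans (ha t).1
  set mA : ℝ≥0∞ := ⨅ v : {v : ℝ → ℝ // memX1 v}, LaE a W v with hmA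
  have hA : ∀ v, memX1 v → mA ≤ LaE a W v := fun v hv => iInf_le _ (⟨v, hv⟩ : {v // memX1 v})
  by_cases hlt : LaE b W w ≤ mA
  · refine ⟨w, hw, fun v hv => le_trans ?_ (hlt.trans (hA v hv))⟩
    exact lintegral_mono fun t => ENNReal.ofReal_le_ofReal
      (add_le_add le_rfl (mul_le_mul_of_nonneg_right (hab t) (hW.nonneg _)))
  obtain ⟨η, hη, S, hS⟩ := exists_localization hW ha₁ ha hlimT hlimB (not_le.1 hlt) hA hwmin
  have hmAfin : mA ≠ ∞ := ne_top_of_lt (not_le.1 hlt)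
  have hex : ∀ n : ℕ, ∃ v, memX1 v ∧ (∀ t, v t ∈ Icc (-1 : ℝ) 1) ∧
      LaE a W v ≤ mA + ENNReal.ofReal (η / (n + 1)) := by
    intro n
    have : mA < mA + ENNReal.ofReal (η / (n + 1)) :=
      ENNReal.lt_add_right hmAfin (by simp; positivity)
    obtain ⟨⟨v, hv⟩, hvlt⟩ := iInf_lt_iff.1 (hmA ▸ this)
    exact ⟨fun t => clamp (v t), hv.clamp, fun t => clamp_mem _,
      (LaE_clamp_le ha0 hW hv.1.continuous).trans hvlt.le⟩
  choose v hv hv1 hvle using hex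
  obtain ⟨φ, hφ, u, hu, hlim⟩ := exists_subseq_tendsto (fun n => (hv n).1) hv1
  have hbd : Tendsto (fun n => mA + ENNReal.ofReal (η / ((φ n : ℕ) + 1))) atTop (𝓝 mA) := by
    have h1 : Tendsto (fun n : ℕ => η / ((n : ℝ) + 1)) atTop (𝓝 0) :=
      tendsto_const_nhds.div_atTop (tendsto_atTop_add_const_right _ _ tendsto_natCast_atTop_atTop)
    have h2 := tendsto_const_nhds (x := mA).add
      (ENNReal.tendsto_ofReal (h1.comp hφ.tendsto_atTop))
    simpa using h2
  have hule : LaE a W u ≤ mA := by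
    refine (LaE_le_liminf hma ha0 hW.continuous hW.nonneg (fun n => (hv (φ n)).1) hu hlim).trans ?_
    rw [← hbd.liminf_eq]
    exact liminf_le_liminf (Eventually.of_forall fun n => hvle (φ n))
  have hfin : LaE a W u ≠ ∞ := ne_top_of_le_ne_top hmAfin hule
  have hu1 : ∀ t, u t ∈ Icc (-1 : ℝ) 1 := fun t =>
    isClosed_Icc.mem_of_tendsto (hlim t) (Eventually.of_forall fun n => hv1 _ t)
  have hloc : ∀ n, (∀ t ≥ S, 0 ≤ v n t) ∧ ∀ t ≤ -S, v n t ≤ 0 := fun n =>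
    hS _ (hv n) (hv1 n) ((hvle n).trans (add_le_add le_rfl (ENNReal.ofReal_le_ofReal
      (div_le_self hη.le (by linarith [Nat.cast_nonneg (α := ℝ) n])))))
  have hpos : ∀ t ≥ S, u t ∈ Icc (0 : ℝ) 1 := fun t ht =>
    ⟨ge_of_tendsto' (hlim t) fun n => (hloc _).1 t ht, (hu1 t).2⟩
  have hneg : ∀ t ≤ -S, u t ∈ Icc (-1 : ℝ) 0 := fun t ht =>
    ⟨(hu1 t).1, le_of_tendsto' (hlim t) fun n => (hloc _).2 t ht⟩
  exact ⟨u, ⟨hu, tendsto_one_of_LaE_ne_top hW ha₁ (fun t => (ha t).1) hu hpos hfin,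
    tendsto_neg_one_of_LaE_ne_top hW ha₁ (fun t => (ha t).1) hu hneg hfin⟩,
    fun w hw => hule.trans (hA w hw)⟩

/-- The inverse of `p ↦ p / √(1 - p²)`. -/
def psi (s : ℝ) : ℝ := s / Real.sqrt (1 + s ^ 2)

lemma one_le_sqrt_one_add_sq (s : ℝ) : 1 ≤ Real.sqrt (1 + s ^ 2) :=
  Real.one_le_sqrt.2 (by nlinarith [sq_nonneg s])

lemma sqrt_one_add_sq_pos (s : ℝ) : 0 < Real.sqrt (1 + s ^ 2) :=
  zero_lt_one.trans_le (one_le_sqrt_one_add_sq s)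

lemma psi_eq_sin_arctan (s : ℝ) : psi s = Real.sin (Real.arctan s) := (Real.sin_arctan s).symm

lemma continuous_psi : Continuous psi :=
  continuous_id.div (by fun_prop) fun s => (sqrt_one_add_sq_pos s).ne'

lemma sqrt_one_sub_psi_sq (s : ℝ) : Real.sqrt (1 - psi s ^ 2) = 1 / Real.sqrt (1 + s ^ 2) := by
  have hr := sqrt_one_add_sq_pos s
  have hr2 : Real.sqrt (1 + s ^ 2) ^ 2 = 1 + s ^ 2 := Real.sq_sqrt (by positivity)
  rw [show 1 - psi s ^ 2 = (1 / Real.sqrt (1 + s ^ 2)) ^ 2 by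
    unfold psi
    field_simp
    linarith]
  exact Real.sqrt_sq (by positivity)

lemma psi_div_sqrt (s : ℝ) : psi s / Real.sqrt (1 - psi s ^ 2) = s := by
  rw [sqrt_one_sub_psi_sq]
  have hr := sqrt_one_add_sq_pos s
  unfold psi
  field_simp

lemma abs_psi_lt_one (s : ℝ) : |psi s| < 1 := by
  have hr := sqrt_one_add_sq_pos s
  have hr2 : Real.sqrt (1 + s ^ 2) ^ 2 = 1 + s ^ 2 := Real.sq_sqrt (by positivity)
  rw [psi, abs_div, abs_of_pos hr, div_lt_one hr]
  exact abs_lt_of_sq_lt_sq (by linarith) hr.le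

lemma monotone_psi : Monotone psi := by
  intro s t hst
  rw [psi_eq_sin_arctan, psi_eq_sin_arctan]
  exact Real.strictMonoOn_sin.monotoneOn ⟨(Real.neg_pi_div_two_lt_arctan s).le,
    (Real.arctan_lt_pi_div_two s).le⟩ ⟨(Real.neg_pi_div_two_lt_arctan t).le,
    (Real.arctan_lt_pi_div_two t).le⟩ (Real.arctan_mono hst)

lemma exists_psi_eq {p : ℝ} (hp : |p| < 1) : ∃ s, psi s = p := by
  obtain ⟨h1, h2⟩ := abs_lt.1 hp
  refine ⟨Real.tan (Real.arcsin p), ?_⟩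
  rw [psi_eq_sin_arctan, Real.arctan_tan (Real.neg_pi_div_two_lt_arcsin.2 h1)
    (Real.arcsin_lt_pi_div_two.2 h2), Real.sin_arcsin h1.le h2.le]

lemma bregman_eq (p s : ℝ) :
    kin p - kin (psi s) - s * (p - psi s)
      = Real.sqrt (1 + s ^ 2) - (Real.sqrt (1 - p ^ 2) + s * p) := by
  have hr := sqrt_one_add_sq_pos s
  have hr2 : Real.sqrt (1 + s ^ 2) ^ 2 = 1 + s ^ 2 := Real.sq_sqrt (by positivity)
  rw [kin, kin, sqrt_one_sub_psi_sq, psi]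
  field_simp
  linear_combination (-1 : ℝ) * hr2

lemma add_sq_add_sub_sq {p : ℝ} (hp : |p| ≤ 1) (s : ℝ) :
    (Real.sqrt (1 - p ^ 2) + s * p) ^ 2 + (p - s * Real.sqrt (1 - p ^ 2)) ^ 2
      = Real.sqrt (1 + s ^ 2) ^ 2 := by
  have hq2 : Real.sqrt (1 - p ^ 2) ^ 2 = 1 - p ^ 2 :=
    Real.sq_sqrt (by nlinarith [sq_abs p, abs_nonneg p])
  rw [Real.sq_sqrt (by positivity)]
  linear_combination (1 + s ^ 2) * hq2

lemma bregman_nonneg {p : ℝ} (hp : |p| ≤ 1) (s : ℝ) :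
    0 ≤ kin p - kin (psi s) - s * (p - psi s) := by
  rw [bregman_eq, sub_nonneg]
  refine (abs_le_of_sq_le_sq' ?_ (Real.sqrt_nonneg _)).2
  rw [← add_sq_add_sub_sq hp s]
  nlinarith [sq_nonneg (p - s * Real.sqrt (1 - p ^ 2))]

lemma eq_psi_of_bregman_eq_zero {p s : ℝ} (hp : |p| ≤ 1)
    (h : kin p - kin (psi s) - s * (p - psi s) = 0) : p = psi s := by
  have hr := sqrt_one_add_sq_pos s
  have h2 := add_sq_add_sub_sq hp s
  rw [bregman_eq] at h
  have h3 : Real.sqrt (1 - p ^ 2) + s * p = Real.sqrt (1 + s ^ 2) := by linarith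
  rw [h3] at h2
  have h4 : p - s * Real.sqrt (1 - p ^ 2) = 0 := by
    have : (p - s * Real.sqrt (1 - p ^ 2)) ^ 2 = 0 := by linarith
    exact pow_eq_zero_iff (two_ne_zero) |>.1 this
  rw [psi, eq_div_iff hr.ne', ← h3]
  have hq2 : Real.sqrt (1 - p ^ 2) ^ 2 = 1 - p ^ 2 :=
    Real.sq_sqrt (by nlinarith [sq_abs p, abs_nonneg p])
  linear_combination Real.sqrt (1 - p ^ 2) * h4 + s * hq2

lemma exists_integral_psi_eq {H : ℝ → ℝ} (hH : Continuous H) {α β A : ℝ} (hαβ : α < β)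
    (hA : |A| < β - α) : ∃ c, ∫ t in α..β, psi (H t + c) = A := by
  obtain ⟨M, hM⟩ := isCompact_Icc.exists_bound_of_continuousOn (s := Icc α β) hH.continuousOn
  have hβ : 0 < β - α := sub_pos.2 hαβ
  obtain ⟨s, hs⟩ := exists_psi_eq (p := A / (β - α)) (by
    rw [abs_div, abs_of_pos hβ, div_lt_one hβ]; exact hA)
  have hconst : ∫ _ in α..β, psi s = A := by
    rw [intervalIntegral.integral_const, smul_eq_mul, hs]
    field_simp
  have hintg (c : ℝ) : IntervalIntegrable (fun t => psi (H t + c)) volume α β :=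
    (continuous_psi.comp (by fun_prop)).intervalIntegrable _ _
  have hcont : Continuous fun c => ∫ t in α..β, psi (H t + c) :=
    intervalIntegral.continuous_parametric_intervalIntegral_of_continuous'
      (f := fun c t => psi (H t + c)) (continuous_psi.comp (by fun_prop)) _ _
  refine mem_range_of_exists_le_of_exists_ge hcont ⟨s - M, ?_⟩ ⟨s + M, ?_⟩
  · rw [← hconst]
    refine intervalIntegral.integral_mono_on hαβ.le (hintg _) (by simp) fun t ht => monotone_psi ?_
    linarith [(abs_le.1 (hM t ht)).2]
  · rw [← hconst]
    refine intervalIntegral.integral_mono_on hαβ.le (by simp) (hintg _) fun t ht => monotone_psi ?_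
    linarith [(abs_le.1 (hM t ht)).1]

lemma lipschitz_glue {f g : ℝ → ℝ} (hf : LipschitzWith 1 f) (hg : LipschitzWith 1 g) {c : ℝ}
    (hc : f c = g c) : LipschitzWith 1 fun t => if t ≤ c then f t else g t := by
  refine lipschitzWith_one_of_le fun s t hst => ?_
  have h1 := abs_sub_le_of_lipschitz hf s t
  have h2 := abs_sub_le_of_lipschitz hg s t
  rw [abs_of_nonneg (sub_nonneg.2 hst)] at h1 h2
  split_ifs with h3 h4 h4
  · exact h1
  · exact absurd (hst.trans h3) h4
  · have h5 := abs_sub_le_of_lipschitz hf s c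
    have h6 := abs_sub_le_of_lipschitz hg c t
    rw [abs_of_nonneg (sub_nonneg.2 h4)] at h5
    rw [abs_of_nonneg (sub_nonneg.2 (not_le.1 h3).le)] at h6
    calc |g t - f s| = |(g t - g c) + (f c - f s)| := by rw [hc]; ring_nf
      _ ≤ |g t - g c| + |f c - f s| := abs_add_le _ _
      _ ≤ t - s := by linarith
  · exact h2

lemma exists_abs_le_of_memX1 {u : ℝ → ℝ} (hu : memX1 u) : ∃ M, ∀ t, |u t| ≤ M := by
  obtain ⟨hL, hT, hB⟩ := hu
  obtain ⟨t1, h1⟩ := eventually_atTop.1 (hT.eventually_mem (Icc_mem_nhds one_pos one_lt_two))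
  obtain ⟨t0, h0⟩ := eventually_atBot.1 (hB.eventually_mem
    (Icc_mem_nhds (show (-2 : ℝ) < -1 by norm_num) (show (-1 : ℝ) < 0 by norm_num)))
  obtain ⟨M, hM⟩ := isCompact_Icc.exists_bound_of_continuousOn (s := Icc t0 t1)
    hL.continuous.continuousOn
  refine ⟨max M 2, fun t => ?_⟩
  rcases le_total t t0 with h | h
  · exact (abs_le.2 ⟨(h0 t h).1, (h0 t h).2.trans (by norm_num)⟩).trans (le_max_right _ _)
  rcases le_total t t1 with h' | h'
  · exact (hM t ⟨h, h'⟩).trans (le_max_left _ _)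
  · exact (abs_le.2 ⟨by linarith [(h1 t h').1], (h1 t h').2⟩).trans (le_max_right _ _)

lemma integrableOn_Icc_of_abs_le {f : ℝ → ℝ} (hf : Measurable f) {C : ℝ} (hC : ∀ t, |f t| ≤ C)
    (α β : ℝ) : IntegrableOn f (Icc α β) :=
  Measure.integrableOn_of_bounded (M := C) (by simp) hf.aestronglyMeasurable
    (ae_of_all _ hC)

lemma setLIntegral_dens_eq {a W u : ℝ → ℝ} (hma : Measurable a) (ha0 : ∀ t, 0 ≤ a t)
    {a₂ : ℝ} (ha₂ : ∀ t, a t ≤ a₂) (hW : DoubleWell W) (hu : memX1 u) (α β : ℝ) :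
    IntegrableOn (fun t => kin (deriv u t) + a t * W (u t)) (Icc α β) ∧
    ∫⁻ t in Icc α β, dens a W u t
      = ENNReal.ofReal (∫ t in Icc α β, (kin (deriv u t) + a t * W (u t))) := by
  obtain ⟨M, hM⟩ := exists_abs_le_of_memX1 hu
  obtain ⟨C, hC⟩ := isCompact_Icc.exists_bound_of_continuousOn (s := Icc (-M) M)
    hW.continuous.continuousOn
  have hintg : IntegrableOn (fun t => kin (deriv u t) + a t * W (u t)) (Icc α β) := by
    refine integrableOn_Icc_of_abs_le (C := 1 + a₂ * C) ?_ (fun t => ?_) α β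
    · exact (continuous_kin.measurable.comp (measurable_deriv u)).add
        (hma.mul (hW.continuous.measurable.comp hu.1.continuous.measurable))
    · have h1 : W (u t) ≤ C := (le_abs_self _).trans (hC _ (abs_le.1 (hM t)))
      have h2 := mul_nonneg (ha0 t) (hW.nonneg (u t))
      rw [abs_of_nonneg (add_nonneg (kin_nonneg _) h2)]
      have h3 : a t * W (u t) ≤ a₂ * C :=
        mul_le_mul (ha₂ t) h1 (hW.nonneg _) ((ha0 t).trans (ha₂ t))
      linarith [kin_le_one (deriv u t)]
  refine ⟨hintg, ?_⟩
  rw [ofReal_integral_eq_lintegral_ofReal hintg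
    (ae_of_all _ fun t => add_nonneg (kin_nonneg _) (mul_nonneg (ha0 t) (hW.nonneg _)))]
  rfl

lemma memX1_lineMap {u w : ℝ → ℝ} (hu : memX1 u) (hw : LipschitzWith 1 w) {α β : ℝ}
    (huw : ∀ t, t ∉ Icc α β → w t = u t) {s : ℝ} (hs : s ∈ Icc (0 : ℝ) 1) :
    memX1 fun t => u t + s * (w t - u t) := by
  refine ⟨lipschitzWith_one_of_le fun x y hxy => ?_, ?_, ?_⟩
  · have h1 := abs_sub_le_of_lipschitz hu.1 x y
    have h2 := abs_sub_le_of_lipschitz hw x y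
    rw [abs_of_nonneg (sub_nonneg.2 hxy)] at h1 h2
    calc |u y + s * (w y - u y) - (u x + s * (w x - u x))|
        = |(1 - s) * (u y - u x) + s * (w y - w x)| := by ring_nf
      _ ≤ (1 - s) * |u y - u x| + s * |w y - w x| := by
        refine (abs_add_le _ _).trans_eq ?_
        rw [abs_mul, abs_mul, abs_of_nonneg (sub_nonneg.2 hs.2), abs_of_nonneg hs.1]
      _ ≤ (1 - s) * (y - x) + s * (y - x) :=
        add_le_add (mul_le_mul_of_nonneg_left h1 (sub_nonneg.2 hs.2))
          (mul_le_mul_of_nonneg_left h2 hs.1)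
      _ = y - x := by ring
  · refine hu.2.1.congr' ?_
    filter_upwards [eventually_gt_atTop β] with t ht
    rw [huw t fun h => absurd h.2 (not_le.2 ht)]
    ring
  · refine hu.2.2.congr' ?_
    filter_upwards [eventually_lt_atBot α] with t ht
    rw [huw t fun h => absurd h.1 (not_le.2 ht)]
    ring

lemma setIntegral_le_of_minimizer {a W u v : ℝ → ℝ} (hma : Measurable a) (ha0 : ∀ t, 0 ≤ a t)
    {a₂ : ℝ} (ha₂ : ∀ t, a t ≤ a₂) (hW : DoubleWell W) (hu : memX1 u) (hfin : LaE a W u ≠ ∞)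
    (hv : memX1 v) (huv : LaE a W u ≤ LaE a W v) {α β : ℝ}
    (hout : ∀ t, t ∉ Icc α β → v t = u t) :
    ∫ t in Icc α β, (kin (deriv u t) + a t * W (u t))
      ≤ ∫ t in Icc α β, (kin (deriv v t) + a t * W (v t)) := by
  have hcompl : ∫⁻ t in (Icc α β)ᶜ, dens a W v t = ∫⁻ t in (Icc α β)ᶜ, dens a W u t := by
    refine setLIntegral_congr_fun measurableSet_Icc.compl fun t ht => ?_
    have hev : v =ᶠ[𝓝 t] u := by
      filter_upwards [isClosed_Icc.isOpen_compl.mem_nhds ht] with r hr using hout r hr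
    simp only [dens, hev.deriv_eq, hout t ht]
  have hne : ∫⁻ t in (Icc α β)ᶜ, dens a W u t ≠ ∞ :=
    ne_top_of_le_ne_top hfin (setLIntegral_le_lintegral _ _)
  rw [LaE_eq_lintegral_dens, LaE_eq_lintegral_dens,
    ← lintegral_add_compl (dens a W u) (measurableSet_Icc (a := α) (b := β)),
    ← lintegral_add_compl (dens a W v) (measurableSet_Icc (a := α) (b := β)), hcompl,
    ENNReal.add_le_add_iff_right hne, (setLIntegral_dens_eq hma ha0 ha₂ hW hu α β).2,
    (setLIntegral_dens_eq hma ha0 ha₂ hW hv α β).2, ENNReal.ofReal_le_ofReal_iff] at huv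
  · exact huv
  · exact integral_nonneg fun t => add_nonneg (kin_nonneg _) (mul_nonneg (ha0 t) (hW.nonneg _))

lemma deriv_W_bound {W u : ℝ → ℝ} (hW : DoubleWell W) (hu : memX1 u) :
    ∃ K, ∀ t, |deriv W (u t)| ≤ K := by
  obtain ⟨M, hM⟩ := exists_abs_le_of_memX1 hu
  obtain ⟨C, hC⟩ := isCompact_Icc.exists_bound_of_continuousOn (s := Icc (-M) M)
    (hW.1.continuous_deriv le_rfl).continuousOn
  exact ⟨C, fun t => hC _ (abs_le.1 (hM t))⟩

lemma first_variation_nonneg {a W u w : ℝ → ℝ} (hma : Measurable a) (ha0 : ∀ t, 0 ≤ a t)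
    {a₂ : ℝ} (ha₂ : ∀ t, a t ≤ a₂) (hW : DoubleWell W) (hu : memX1 u) (hfin : LaE a W u ≠ ∞)
    (hmin : ∀ v, memX1 v → LaE a W u ≤ LaE a W v) (hw : LipschitzWith 1 w) {α β : ℝ}
    (huw : ∀ t, t ∉ Icc α β → w t = u t) :
    0 ≤ ∫ t in Icc α β,
      (kin (deriv w t) - kin (deriv u t) + a t * deriv W (u t) * (w t - u t)) := by
  have hwX : memX1 w := by
    simpa using memX1_lineMap hu hw huw (right_mem_Icc.2 zero_le_one)
  obtain ⟨M₁, hM₁⟩ := exists_abs_le_of_memX1 hu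
  obtain ⟨M₂, hM₂⟩ := exists_abs_le_of_memX1 hwX
  set M := max M₁ M₂
  have huM (t : ℝ) : u t ∈ Icc (-M) M := abs_le.1 ((hM₁ t).trans (le_max_left _ _))
  have hwM (t : ℝ) : w t ∈ Icc (-M) M := abs_le.1 ((hM₂ t).trans (le_max_right _ _))
  obtain ⟨K, hK⟩ := hW.1.contDiffOn.exists_lipschitzOnWith one_ne_zero (convex_Icc (-M) M)
    isCompact_Icc
  have hvM {s : ℝ} (hs : s ∈ Ioc (0 : ℝ) 1) (t : ℝ) : u t + s * (w t - u t) ∈ Icc (-M) M := by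
    have := convex_Icc (-M) M (huM t) (hwM t) (sub_nonneg.2 hs.2) hs.1.le (by ring)
    simp only [smul_eq_mul] at this
    convert this using 1
    ring
  have hquot {s : ℝ} (hs : s ∈ Ioc (0 : ℝ) 1) (t : ℝ) :
      |s⁻¹ * (W (u t + s * (w t - u t)) - W (u t))| ≤ K * (2 * M) := by
    have h1 := hK.dist_le_mul _ (hvM hs t) _ (huM t)
    rw [Real.dist_eq, Real.dist_eq, add_sub_cancel_left, abs_mul, abs_of_pos hs.1] at h1
    have h2 : |w t - u t| ≤ 2 * M :=
      abs_le.2 ⟨by linarith [(huM t).2, (hwM t).1], by linarith [(huM t).1, (hwM t).2]⟩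
    rw [abs_mul, abs_of_pos (inv_pos.2 hs.1), inv_mul_le_iff₀ hs.1]
    calc _ ≤ K * (s * |w t - u t|) := h1
      _ = s * (K * |w t - u t|) := by ring
      _ ≤ s * (K * (2 * M)) := mul_le_mul_of_nonneg_left
        (mul_le_mul_of_nonneg_left h2 K.coe_nonneg) hs.1.le
  have hmquot (s : ℝ) : Measurable fun t => kin (deriv w t) - kin (deriv u t)
      + a t * (s⁻¹ * (W (u t + s * (w t - u t)) - W (u t))) := by
    have h1 := hu.1.continuous.measurable
    have h2 := hw.continuous.measurable
    have h3 := hW.continuous.measurable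
    have h4 := continuous_kin.measurable
    fun_prop
  have hbound {s : ℝ} (hs : s ∈ Ioc (0 : ℝ) 1) (t : ℝ) : |kin (deriv w t) - kin (deriv u t)
      + a t * (s⁻¹ * (W (u t + s * (w t - u t)) - W (u t)))| ≤ 1 + a₂ * (K * (2 * M)) := by
    refine (abs_add_le _ _).trans (add_le_add ?_ ?_)
    · exact abs_le.2 ⟨by linarith [kin_nonneg (deriv w t), kin_le_one (deriv u t)],
        by linarith [kin_nonneg (deriv u t), kin_le_one (deriv w t)]⟩
    · rw [abs_mul, abs_of_nonneg (ha0 t)]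
      exact mul_le_mul (ha₂ t) (hquot hs t) (abs_nonneg _) ((ha0 t).trans (ha₂ t))
  have hnonneg {s : ℝ} (hs : s ∈ Ioc (0 : ℝ) 1) : 0 ≤ ∫ t in Icc α β,
      (kin (deriv w t) - kin (deriv u t)
        + a t * (s⁻¹ * (W (u t + s * (w t - u t)) - W (u t)))) := by
    have hvX := memX1_lineMap hu hw huw (Ioc_subset_Icc_self hs)
    have hle := setIntegral_le_of_minimizer hma ha0 ha₂ hW hu hfin hvX (hmin _ hvX)
      (α := α) (β := β) fun t ht => by rw [huw t ht]; ring
    have hiu := (setLIntegral_dens_eq hma ha0 ha₂ hW hu α β).1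
    have hiv := (setLIntegral_dens_eq hma ha0 ha₂ hW hvX α β).1
    rw [← sub_nonneg, ← integral_sub hiv hiu] at hle
    have hmul : 0 ≤ s * ∫ t in Icc α β, (kin (deriv w t) - kin (deriv u t)
        + a t * (s⁻¹ * (W (u t + s * (w t - u t)) - W (u t)))) := by
      rw [← integral_const_mul]
      refine hle.trans (integral_mono_ae (hiv.sub hiu)
        ((integrableOn_Icc_of_abs_le (hmquot s) (hbound hs) α β).const_mul s)
        (ae_restrict_of_ae ?_))
      filter_upwards [hu.1.ae_differentiableAt_real, hw.ae_differentiableAt_real] with t h1 h2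
      have hd : deriv (fun t => u t + s * (w t - u t)) t
          = (1 - s) • deriv u t + s • deriv w t := by
        refine (h1.hasDerivAt.fun_add
          ((h2.hasDerivAt.fun_sub h1.hasDerivAt).const_mul s)).deriv.trans ?_
        simp only [smul_eq_mul]
        ring
      have hc := convexOn_kin.2 (deriv_mem_Icc hu.1 t) (deriv_mem_Icc hw t)
        (sub_nonneg.2 hs.2) hs.1.le (by ring)
      rw [← hd] at hc
      simp only [smul_eq_mul] at hc
      have hs0 := hs.1.ne'
      have : s * (kin (deriv w t) - kin (deriv u t)
          + a t * (s⁻¹ * (W (u t + s * (w t - u t)) - W (u t))))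
          = s * (kin (deriv w t) - kin (deriv u t))
            + a t * (W (u t + s * (w t - u t)) - W (u t)) := by
        field_simp
      rw [this]
      linarith
    exact nonneg_of_mul_nonneg_right hmul hs.1
  have hev : ∀ᶠ s in 𝓝[>] (0 : ℝ), s ∈ Ioc (0 : ℝ) 1 := Ioc_mem_nhdsGT one_pos
  refine ge_of_tendsto (tendsto_integral_filter_of_dominated_convergence
    (l := 𝓝[>] (0 : ℝ)) (fun _ => 1 + a₂ * (K * (2 * M)))
    (Eventually.of_forall fun s => (hmquot s).aestronglyMeasurable)
    (hev.mono fun s hs => ae_of_all _ fun t => hbound hs t) (by simp)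
    (ae_of_all _ fun t => ?_)) (hev.mono fun s hs => hnonneg hs)
  have hWd : HasDerivAt W (deriv W (u t)) (u t + 0 * (w t - u t)) := by
    simpa using (hW.1.differentiable one_ne_zero (u t)).hasDerivAt
  have hline : HasDerivAt (fun s : ℝ => u t + s * (w t - u t)) (w t - u t) 0 := by
    simpa using ((hasDerivAt_id (0 : ℝ)).mul_const (w t - u t)).const_add (u t)
  have := (hWd.comp (0 : ℝ) hline).tendsto_slope_zero_right
  simp only [Function.comp_def, zero_add, zero_mul, add_zero, smul_eq_mul] at this
  rw [mul_assoc]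
  exact tendsto_const_nhds.add (this.const_mul (a t))

lemma locallyIntegrable_of_abs_le {f : ℝ → ℝ} (hf : Measurable f) {C : ℝ} (hC : ∀ t, |f t| ≤ C) :
    LocallyIntegrable f volume :=
  (locallyIntegrable_const C).mono hf.aestronglyMeasurable
    (ae_of_all _ fun t => (hC t).trans (le_abs_self C))

lemma intervalIntegrable_of_abs_le {f : ℝ → ℝ} (hf : Measurable f) {C : ℝ} (hC : ∀ t, |f t| ≤ C)
    (s t : ℝ) : IntervalIntegrable f volume s t :=
  intervalIntegrable_const (c := C) |>.mono_fun hf.aestronglyMeasurable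
    (ae_of_all _ fun t => (hC t).trans (le_abs_self C))

lemma lipschitz_primitive {f : ℝ → ℝ} (hf : Measurable f) {C : ℝ} (hC : ∀ t, |f t| ≤ C) :
    LipschitzWith C.toNNReal fun t => ∫ r in (0 : ℝ)..t, f r := by
  refine LipschitzWith.of_dist_le_mul fun t s => ?_
  rw [Real.dist_eq, Real.dist_eq, Real.coe_toNNReal _ ((abs_nonneg _).trans (hC 0)),
    intervalIntegral.integral_interval_sub_left (intervalIntegrable_of_abs_le hf hC _ _)
      (intervalIntegrable_of_abs_le hf hC _ _)]
  exact intervalIntegral.norm_integral_le_of_norm_le_const (f := f) fun x _ => hC x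

lemma eq_of_minimizer_on_Icc {a W u : ℝ → ℝ} (hma : Measurable a) (ha0 : ∀ t, 0 ≤ a t)
    {a₂ : ℝ} (ha₂ : ∀ t, a t ≤ a₂) (hW : DoubleWell W) (hu : memX1 u) (hfin : LaE a W u ≠ ∞)
    (hmin : ∀ v, memX1 v → LaE a W u ≤ LaE a W v) {α β C : ℝ} (hαβ : α < β)
    (hslope : |u β - u α| < β - α) (hC : ∀ t, |a t * deriv W (u t)| ≤ C) :
    ∃ c, ∀ t ∈ Icc α β,
      u t = u α + ∫ r in α..t, psi ((∫ x in (0 : ℝ)..r, a x * deriv W (u x)) + c) := by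
  set h : ℝ → ℝ := fun t => a t * deriv W (u t) with hh
  have hmh : Measurable h := hma.mul
    ((hW.1.continuous_deriv le_rfl).measurable.comp hu.1.continuous.measurable)
  set H : ℝ → ℝ := fun t => ∫ r in (0 : ℝ)..t, h r with hH
  have hHL : LipschitzWith C.toNNReal H := lipschitz_primitive hmh hC
  obtain ⟨c, hc⟩ := exists_integral_psi_eq hHL.continuous hαβ hslope
  refine ⟨c, ?_⟩
  set G : ℝ → ℝ := fun t => psi (H t + c) with hG
  have hGc : Continuous G := continuous_psi.comp (hHL.continuous.add continuous_const)
  set y : ℝ → ℝ := fun t => u α + ∫ r in α..t, G r with hy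
  have hyd (t : ℝ) : HasDerivAt y (G t) t :=
    (hGc.integral_hasStrictDerivAt α t).hasDerivAt.const_add (u α)
  have hyL : LipschitzWith 1 y := by
    refine lipschitzWith_of_nnnorm_deriv_le (fun t => (hyd t).differentiableAt) fun t => ?_
    rw [(hyd t).deriv]
    exact (abs_psi_lt_one _).le
  have hyα : y α = u α := by simp [hy]
  have hyβ : y β = u β := by simp only [hy]; rw [hc]; ring
  set w : ℝ → ℝ := fun t => if t ≤ α then u t else if t ≤ β then y t else u t with hw
  have hwL : LipschitzWith 1 w :=
    lipschitz_glue hu.1 (lipschitz_glue hyL hu.1 hyβ) (by rw [if_pos hαβ.le, hyα])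
  have hw_out (t : ℝ) (ht : t ∉ Icc α β) : w t = u t := by
    simp only [hw]
    split_ifs with h1 h2
    · rfl
    · exact absurd ⟨(not_le.1 h1).le, h2⟩ ht
    · rfl
  have hw_in (t : ℝ) (ht : t ∈ Icc α β) : w t = y t := by
    simp only [hw]
    split_ifs with h1
    · rw [le_antisymm h1 ht.1, hyα]
    · rfl
    · exact absurd ht.2 ‹_›
  have hvar := first_variation_nonneg hma ha0 ha₂ hW hu hfin hmin hwL hw_out
  have hvar' : 0 ≤ ∫ t in α..β, (kin (G t) - kin (deriv u t) + h t * (y t - u t)) := by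
    rw [intervalIntegral.integral_of_le hαβ.le, ← integral_Icc_eq_integral_Ioc,
      integral_Icc_eq_integral_Ioo]
    rw [integral_Icc_eq_integral_Ioo] at hvar
    refine hvar.trans_eq (setIntegral_congr_fun measurableSet_Ioo fun t ht => ?_)
    have hev : w =ᶠ[𝓝 t] y := by
      filter_upwards [Icc_mem_nhds ht.1 ht.2] with r hr using hw_in r hr
    simp only [hev.deriv_eq, (hyd t).deriv, hw_in t (Ioo_subset_Icc_self ht), hh]
  have hGl : LipschitzWith C.toNNReal fun t => H t + c := by
    simpa using hHL.add (LipschitzWith.const c)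
  have hdL : LipschitzWith (1 + 1) fun t => y t - u t := hyL.sub hu.1
  have hparts := AbsolutelyContinuousOnInterval.integral_deriv_mul_eq_sub
    (hGl.lipschitzOnWith (s := uIcc α β)).absolutelyContinuousOnInterval
    (hdL.lipschitzOnWith (s := uIcc α β)).absolutelyContinuousOnInterval
  rw [hyα, hyβ, sub_self, sub_self, mul_zero, mul_zero, sub_zero] at hparts
  have hmu := measurable_deriv u
  have hGH (t : ℝ) : kin (deriv u t) - kin (G t) - (H t + c) * (deriv u t - G t) =
      (h t * (y t - u t) + (H t + c) * (G t - deriv u t))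
        - (kin (G t) - kin (deriv u t) + h t * (y t - u t)) := by ring
  have hparts' : ∫ t in α..β, (h t * (y t - u t) + (H t + c) * (G t - deriv u t)) = 0 := by
    rw [← hparts]
    refine intervalIntegral.integral_congr_ae ?_
    filter_upwards [LocallyIntegrable.ae_hasDerivAt_integral (locallyIntegrable_of_abs_le hmh hC),
      hu.1.ae_differentiableAt_real] with t h1 h2 _
    rw [((h1 0).add_const c).deriv, ((hyd t).fun_sub h2.hasDerivAt).deriv]
  have hbint {f : ℝ → ℝ} (hf : Measurable f) {B : ℝ} (hB : ∀ t, |f t| ≤ B) :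
      IntervalIntegrable f volume α β := intervalIntegrable_of_abs_le hf hB α β
  have hi_u : IntervalIntegrable (fun t => kin (deriv u t)) volume α β :=
    hbint (continuous_kin.measurable.comp hmu) (B := 1) fun t => by
      rw [abs_of_nonneg (kin_nonneg _)]; exact kin_le_one _
  have hi_u' : IntervalIntegrable (deriv u) volume α β := hbint hmu (abs_deriv_le_one hu.1)
  have hi_G : IntervalIntegrable (fun t => kin (G t)) volume α β :=
    (continuous_kin.comp hGc).intervalIntegrable _ _
  have hi_h : IntervalIntegrable (fun t => h t * (y t - u t)) volume α β :=
    (hbint hmh hC).mul_continuousOn hdL.continuous.continuousOn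
  have hi_d : IntervalIntegrable (fun t => (H t + c) * (G t - deriv u t)) volume α β :=
    ((hGc.intervalIntegrable _ _).sub hi_u').continuousOn_mul hGl.continuous.continuousOn
  have hi1 := (hi_G.sub hi_u).add hi_h
  have hi2 := hi_h.add hi_d
  have hD0 (t : ℝ) : 0 ≤ kin (deriv u t) - kin (G t) - (H t + c) * (deriv u t - G t) :=
    bregman_nonneg (abs_deriv_le_one hu.1 t) _
  have hDi : IntervalIntegrable
      (fun t => kin (deriv u t) - kin (G t) - (H t + c) * (deriv u t - G t)) volume α β := by
    simp only [hGH]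
    exact hi2.sub hi1
  have hDle : ∫ t in α..β, (kin (deriv u t) - kin (G t) - (H t + c) * (deriv u t - G t)) = 0 := by
    refine le_antisymm ?_ (intervalIntegral.integral_nonneg hαβ.le fun t _ => hD0 t)
    simp only [hGH]
    rw [intervalIntegral.integral_sub hi2 hi1, hparts', zero_sub]
    exact neg_nonpos.2 hvar'
  have hae : ∀ᵐ t, t ∈ Ioc α β → deriv u t = G t := by
    rw [← ae_restrict_iff' measurableSet_Ioc]
    have := (intervalIntegral.integral_eq_zero_iff_of_le_of_nonneg_ae hαβ.le
      (ae_of_all _ hD0) hDi).1 hDle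
    filter_upwards [this] with t ht
    exact eq_psi_of_bregman_eq_zero (abs_deriv_le_one hu.1 t) ht
  intro t ht
  have h1 := integral_deriv_of_lipschitz hu.1 α t
  rw [intervalIntegral.integral_congr_ae (g := G)] at h1
  · linarith
  · filter_upwards [hae] with r hr hrt
    rw [uIoc_of_le ht.1] at hrt
    exact hr ⟨hrt.1, hrt.2.trans ht.2⟩

lemma exists_hasDerivAt_of_minimizer {a W u : ℝ → ℝ} (hma : Measurable a) (ha0 : ∀ t, 0 ≤ a t)
    {a₂ : ℝ} (ha₂ : ∀ t, a t ≤ a₂) (hW : DoubleWell W) (hu : memX1 u) (hfin : LaE a W u ≠ ∞)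
    (hmin : ∀ v, memX1 v → LaE a W u ≤ LaE a W v) {C : ℝ}
    (hC : ∀ t, |a t * deriv W (u t)| ≤ C) :
    ∃ c, ∀ t, HasDerivAt u (psi ((∫ x in (0 : ℝ)..t, a x * deriv W (u x)) + c)) t := by
  have hmh : Measurable fun t => a t * deriv W (u t) := hma.mul
    ((hW.1.continuous_deriv le_rfl).measurable.comp hu.1.continuous.measurable)
  set H : ℝ → ℝ := fun t => ∫ x in (0 : ℝ)..t, a x * deriv W (u x) with hH
  have hHc : Continuous H := (lipschitz_primitive hmh hC).continuous
  obtain ⟨M, hM⟩ := exists_abs_le_of_memX1 hu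
  have hM0 : 0 ≤ M := (abs_nonneg _).trans (hM 0)
  have hloc (R : ℝ) (hR : M < R) : ∃ c, ∀ t ∈ Ioo (-R) R, HasDerivAt u (psi (H t + c)) t := by
    have hslope : |u R - u (-R)| < R - -R :=
      abs_lt.2 ⟨by linarith [(abs_le.1 (hM R)).1, (abs_le.1 (hM (-R))).2],
        by linarith [(abs_le.1 (hM R)).2, (abs_le.1 (hM (-R))).1]⟩
    obtain ⟨c, hc⟩ := eq_of_minimizer_on_Icc hma ha0 ha₂ hW hu hfin hmin (by linarith) hslope hC
    refine ⟨c, fun t ht => ?_⟩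
    have hG : Continuous fun r => psi (H r + c) :=
      continuous_psi.comp (hHc.add continuous_const)
    refine ((hG.integral_hasStrictDerivAt (-R) t).hasDerivAt.const_add (u (-R))).congr_of_eventuallyEq
      ?_
    filter_upwards [Icc_mem_nhds ht.1 ht.2] with r hr using hc r hr
  refine ⟨deriv u 0 / Real.sqrt (1 - deriv u 0 ^ 2), fun t => ?_⟩
  have hR : M < M + |t| + 1 := by linarith [abs_nonneg t]
  obtain ⟨c, hc⟩ := hloc (M + |t| + 1) hR
  have h0 : deriv u 0 = psi c := by
    rw [(hc 0 ⟨by linarith, by linarith⟩).deriv]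
    simp [hH]
  rw [h0, psi_div_sqrt]
  exact hc t ⟨by linarith [neg_abs_le t], by linarith [le_abs_self t]⟩

lemma DoubleWell.deriv_eq_zero {W : ℝ → ℝ} (hW : DoubleWell W) {z : ℝ} (hz : W z = 0) :
    deriv W z = 0 :=
  IsLocalMin.deriv_eq_zero (Eventually.of_forall fun s => hz ▸ hW.nonneg s)

lemma tendsto_zero_of_hasDerivAt_psi {u P h : ℝ → ℝ} {l : Filter ℝ}
    (hl : ∀ p : ℝ → Prop, (∀ᶠ t in l, p t) → ∀ᶠ t in l, ∀ r ∈ Icc t (t + 1), p r)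
    (hd : ∀ t, HasDerivAt u (psi (P t)) t) (hP : ∀ s t, P t - P s = ∫ r in s..t, h r)
    {z : ℝ} (hu : Tendsto u l (𝓝 z)) (hh : Tendsto h l (𝓝 0)) : Tendsto P l (𝓝 0) := by
  have hshift : Tendsto (fun t => u (t + 1)) l (𝓝 z) := fun s hs =>
    (hl _ (hu.eventually_mem hs)).mono fun t ht => ht (t + 1) ⟨by linarith, le_rfl⟩
  have hdiff : Tendsto (fun t => u (t + 1) - u t) l (𝓝 0) := by
    simpa using hshift.sub hu
  have hcont : ContinuousAt (fun q : ℝ => q / Real.sqrt (1 - q ^ 2)) 0 :=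
    continuousAt_id.div (by fun_prop) (by simp)
  have hphi : Tendsto (fun t => (u (t + 1) - u t) / Real.sqrt (1 - (u (t + 1) - u t) ^ 2)) l
      (𝓝 0) := by
    have := hcont.tendsto.comp hdiff
    rwa [zero_div] at this
  rw [Metric.tendsto_nhds]
  intro ε hε
  filter_upwards [Metric.tendsto_nhds.1 hphi (ε / 2) (half_pos hε),
    hl _ (Metric.tendsto_nhds.1 hh (ε / 2) (half_pos hε))] with t h1 h2
  simp only [dist_zero_right, Real.norm_eq_abs] at h1 h2 ⊢
  obtain ⟨ξ, hξ, hslope⟩ := exists_hasDerivAt_eq_slope u (fun t => psi (P t))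
    (lt_add_one t) (fun r _ => (hd r).continuousAt.continuousWithinAt) fun r _ => hd r
  rw [add_sub_cancel_left, div_one] at hslope
  rw [← hslope, psi_div_sqrt] at h1
  have h3 : |P t - P ξ| ≤ ε / 2 * |t - ξ| := by
    rw [hP]
    refine intervalIntegral.norm_integral_le_of_norm_le_const (f := h) fun r hr => ?_
    rw [uIoc_of_ge hξ.1.le] at hr
    exact (h2 r ⟨hr.1.le, hr.2.trans hξ.2.le⟩).le
  have h4 : |t - ξ| ≤ 1 := abs_le.2 ⟨by linarith [hξ.2], by linarith [hξ.1]⟩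
  have h5 : |P t| ≤ |P ξ| + |P t - P ξ| := by
    simpa using abs_add_le (P ξ) (P t - P ξ)
  nlinarith

lemma exists_lt_one_of_tendsto_zero {f : ℝ → ℝ} (hf : Continuous f) (hlt : ∀ t, |f t| < 1)
    (hT : Tendsto f atTop (𝓝 0)) (hB : Tendsto f atBot (𝓝 0)) : ∃ c < 1, ∀ t, |f t| ≤ c := by
  by_cases h0 : ∃ t₀, f t₀ ≠ 0
  · obtain ⟨t₀, ht₀⟩ := h0
    have hco : Tendsto (fun t => |f t|) (cocompact ℝ) (𝓝 0) := by
      rw [cocompact_eq_atBot_atTop]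
      simpa using (hB.sup hT).abs
    obtain ⟨t₁, h1⟩ := hf.abs.exists_forall_ge' t₀
      ((hco.eventually_lt_const (abs_pos.2 ht₀)).mono fun t ht => ht.le)
    exact ⟨_, hlt t₁, h1⟩
  · push Not at h0
    exact ⟨0, one_pos, fun t => by simp [h0]⟩

/-- Under `(W₁)`, `(W₂)`, `(a₁)` and the structural assumption `(b₁)`,
`L_a` attains its infimum at some `u_a ∈ X₁`, which is a `C¹ ∩ W^{2,2}_loc` heteroclinic
solution of `(u'/√(1-|u'|²))' = a(t)W'(u)` with `(u,u') → (±1,0)` and `‖u'‖_{L^∞} < 1`. -/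
theorem La_attains_infimum_structural (W a b : ℝ → ℝ) (a₁ a₂ : ℝ)
    (hW : DoubleWell W) (hma : Measurable a)
    (ha₁ : 0 < a₁) (ha : ∀ t : ℝ, a₁ ≤ a t ∧ a t ≤ a₂)
    (hmb : Measurable b) (hbbd : ∃ C : ℝ, ∀ᵐ t ∂(volume : Measure ℝ), |b t| ≤ C)
    (hab : ∀ t : ℝ, a t ≤ b t)
    (hlimT : Tendsto (fun t : ℝ => b t - a t) atTop (𝓝 (0:ℝ)))
    (hlimB : Tendsto (fun t : ℝ => b t - a t) atBot (𝓝 (0:ℝ)))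
    (hbmin : ∃ w : ℝ → ℝ, memX1 w ∧ ∀ v : ℝ → ℝ, memX1 v → LaE b W w ≤ LaE b W v) :
    ∃ u : ℝ → ℝ, memX1 u ∧ (∀ v : ℝ → ℝ, memX1 v → LaE a W u ≤ LaE a W v) ∧
      SolvesEL a W u ∧
      Tendsto u atTop (𝓝 (1:ℝ)) ∧ Tendsto u atBot (𝓝 (-1:ℝ)) ∧
      Tendsto (deriv u) atTop (𝓝 (0:ℝ)) ∧ Tendsto (deriv u) atBot (𝓝 (0:ℝ)) ∧
      ∃ c : ℝ, c < 1 ∧ ∀ t : ℝ, |deriv u t| ≤ c := by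
  obtain ⟨u, hu, hmin⟩ := exists_minimizer hW hma ha₁ ha hab hlimT hlimB hbmin
  have ha0 (t : ℝ) : 0 ≤ a t := ha₁.le.trans (ha t).1
  have ha2 (t : ℝ) : a t ≤ a₂ := (ha t).2
  have hfin : LaE a W u ≠ ∞ := by
    obtain ⟨v, hv, hvfin⟩ := exists_memX1_LaE_ne_top hW ((ha0 0).trans (ha2 0)) ha2
    exact ne_top_of_le_ne_top hvfin (hmin v hv)
  obtain ⟨K, hK⟩ := deriv_W_bound hW hu
  have hC (t : ℝ) : |a t * deriv W (u t)| ≤ a₂ * K := by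
    rw [abs_mul, abs_of_nonneg (ha0 t)]
    exact mul_le_mul (ha2 t) (hK t) (abs_nonneg _) ((ha0 t).trans (ha2 t))
  have hcW : Continuous (deriv W) := hW.1.continuous_deriv le_rfl
  have hmh : Measurable fun t => a t * deriv W (u t) :=
    hma.mul (hcW.measurable.comp hu.1.continuous.measurable)
  obtain ⟨c, hc⟩ := exists_hasDerivAt_of_minimizer hma ha0 ha2 hW hu hfin hmin hC
  set P : ℝ → ℝ := fun t => (∫ x in (0 : ℝ)..t, a x * deriv W (u x)) + c with hPdef
  have hd (t : ℝ) : HasDerivAt u (psi (P t)) t := hc t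
  have hderiv : deriv u = fun t => psi (P t) := funext fun t => (hd t).deriv
  have hPc : Continuous P := (lipschitz_primitive hmh hC).continuous.add continuous_const
  have hP (s t : ℝ) : P t - P s = ∫ r in s..t, a r * deriv W (u r) := by
    rw [hPdef, add_sub_add_right_eq_sub]
    exact intervalIntegral.integral_interval_sub_left (intervalIntegrable_of_abs_le hmh hC _ _)
      (intervalIntegrable_of_abs_le hmh hC _ _)
  have hdc : Continuous (deriv u) := hderiv ▸ continuous_psi.comp hPc
  have hforce {l : Filter ℝ} {z : ℝ} (hz : W z = 0) (hul : Tendsto u l (𝓝 z)) :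
      Tendsto (fun t => a t * deriv W (u t)) l (𝓝 0) := by
    have h1 : Tendsto (fun t => a₂ * |deriv W (u t)|) l (𝓝 0) := by
      simpa [hW.deriv_eq_zero hz] using ((hcW.tendsto z).comp hul).abs.const_mul a₂
    refine squeeze_zero_norm (fun t => ?_) h1
    rw [Real.norm_eq_abs, abs_mul, abs_of_nonneg (ha0 t)]
    exact mul_le_mul_of_nonneg_right (ha2 t) (abs_nonneg _)
  have hpsi {l : Filter ℝ} (hPl : Tendsto P l (𝓝 0)) : Tendsto (deriv u) l (𝓝 0) := by
    have := (continuous_psi.tendsto 0).comp hPl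
    rw [show psi 0 = 0 by simp [psi]] at this
    exact hderiv ▸ this
  have hT : Tendsto (deriv u) atTop (𝓝 0) := by
    refine hpsi (tendsto_zero_of_hasDerivAt_psi (fun p hp => ?_) hd hP hu.2.1
      (hforce hW.2.2.1 hu.2.1))
    obtain ⟨t₀, h⟩ := eventually_atTop.1 hp
    exact eventually_atTop.2 ⟨t₀, fun t ht r hr => h r (ht.trans hr.1)⟩
  have hB : Tendsto (deriv u) atBot (𝓝 0) := by
    refine hpsi (tendsto_zero_of_hasDerivAt_psi (fun p hp => ?_) hd hP hu.2.2
      (hforce hW.2.1 hu.2.2))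
    obtain ⟨t₀, h⟩ := eventually_atBot.1 hp
    exact eventually_atBot.2 ⟨t₀ - 1, fun t ht r hr => h r (by linarith [hr.2])⟩
  refine ⟨u, hu, hmin, ⟨contDiff_one_iff_deriv.2 ⟨fun t => (hd t).differentiableAt, hdc⟩,
    fun s t => ?_⟩, hu.2.1, hu.2.2, hT, hB, exists_lt_one_of_tendsto_zero hdc (fun t => ?_) hT hB⟩
  · simp only [hderiv, psi_div_sqrt]
    exact hP s t
  · rw [hderiv]
    exact abs_psi_lt_one _
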